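/- As γ → +∞: (i) liminf ‖u_γ‖_{L²(Ω)} > 0; (ii) ρ_γ → 0; and (iii) u_γ(r) = γ^{−1} log(1/r²) + ‖u_γ‖_{L²(Ω)} v₁(r) + o(‖u_γ‖_{L²(Ω)}) uniformly for r ∈ [ρ_γ, 1]. -/

import Mathlib

open Real Set Filter MeasureTheory Topology

noncomputable section

/-- The radial Laplacian with the sign convention Δ = −div(∇·):
for a radial C² function, (Δu)(r) = −u''(r) − u'(r)/r. -/
def radLap (u : ℝ → ℝ) (r : ℝ) : ℝ := -(deriv (deriv u) r) - deriv u r / r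

/-- `EigenCtx lam1 v1` : λ₁ > 0 is the first radial Dirichlet eigenvalue of Δ = −div∇
on the unit disk, with radial eigenfunction v₁: v₁ smooth on [0,1], Δv₁ = λ₁v₁ in Ω,
v₁ > 0 in Ω, v₁(1) = 0 and ∫_Ω v₁² dy = ∫₀¹ v₁(r)² 2πr dr = 1. -/
def EigenCtx (lam1 : ℝ) (v1 : ℝ → ℝ) : Prop :=
  0 < lam1 ∧ ContDiffOn ℝ (⊤ : ℕ∞) v1 (Set.Icc 0 1) ∧
    (∀ r ∈ Set.Ioo (0:ℝ) 1, radLap v1 r = lam1 * v1 r) ∧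
    (∀ r ∈ Set.Ico (0:ℝ) 1, 0 < v1 r) ∧ v1 1 = 0 ∧
    (∫ r in Set.Ioo (0:ℝ) 1, (v1 r) ^ 2 * (2 * π * r)) = 1

/-- `IsRadSol lam beta gam u` : u is a smooth radial function on the closed unit disk,
positive in the open disk, vanishing on the boundary, with central value γ, solving
Δu = λu + βu e^{u²} in Ω (radially). -/
def IsRadSol (lam beta gam : ℝ) (u : ℝ → ℝ) : Prop :=
  ContDiffOn ℝ (⊤ : ℕ∞) u (Set.Icc 0 1) ∧
    (∀ r ∈ Set.Ioo (0:ℝ) 1,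
      radLap u r = lam * u r + beta * u r * Real.exp ((u r) ^ 2)) ∧
    (∀ r ∈ Set.Ico (0:ℝ) 1, 0 < u r) ∧ u 1 = 0 ∧ u 0 = gam

/-- λ̄_γ = λ₁ − ε_γ with ε_γ = (4π v₁(0)/γ)√(λ₁/l). -/
def lamBar (lam1 v10 l γ : ℝ) : ℝ := lam1 - 4 * π * v10 / γ * Real.sqrt (lam1 / l)

/-- The family (β_γ, u_γ) of Theorem 1: for every γ > 0 with λ̄_γ > 0, β_γ > 0 and u_γ
is a smooth positive radial solution of Δu = λ̄_γ u + β_γ u e^{u²} with u_γ(0) = γ. -/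
def GoodFamily (lam1 : ℝ) (v1 : ℝ → ℝ) (l : ℝ) (β : ℝ → ℝ) (u : ℝ → ℝ → ℝ) : Prop :=
  ∀ γ : ℝ, 0 < γ → 0 < lamBar lam1 (v1 0) l γ →
    0 < β γ ∧ IsRadSol (lamBar lam1 (v1 0) l γ) (β γ) γ (u γ)

/-- Dirichlet energy ∫_Ω |∇u|² dy of a radial function, = ∫₀¹ u'(r)² 2πr dr. -/
def dirEnergy (u : ℝ → ℝ) : ℝ := ∫ r in Set.Ioo (0:ℝ) 1, (deriv u r) ^ 2 * (2 * π * r)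

/-- L² norm ‖u‖_{L²(Ω)} of a radial function. -/
def l2norm (u : ℝ → ℝ) : ℝ := Real.sqrt (∫ r in Set.Ioo (0:ℝ) 1, (u r) ^ 2 * (2 * π * r))

/-- t_γ(r) = log(1 + r²/μ_γ²). -/
def tG (μγ r : ℝ) : ℝ := Real.log (1 + r ^ 2 / μγ ^ 2)

/-- The flux `∫₀ʳ s u(s) ds` of the linear term. -/
def linFlux (u : ℝ → ℝ) (r : ℝ) : ℝ := ∫ s in (0:ℝ)..r, s * u s

/-- The flux `∫₀ʳ s β u(s) exp(u(s)²) ds` of the exponential term. -/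
def expFlux (β : ℝ) (u : ℝ → ℝ) (r : ℝ) : ℝ :=
  ∫ s in (0:ℝ)..r, s * (β * u s * Real.exp ((u s) ^ 2))

/-- The total flux `-r u'(r)` of a radial solution. -/
def flux (lam β : ℝ) (u : ℝ → ℝ) (r : ℝ) : ℝ := expFlux β u r + lam * linFlux u r

/-- A radial solution on the unit disk, extended continuously to `ℝ`, with its equation
integrated once. -/
structure RadialProfile (lam β γ : ℝ) (u : ℝ → ℝ) : Prop where
  lam_nonneg : 0 ≤ lam
  beta_nonneg : 0 ≤ β
  cont : Continuous u
  pos : ∀ r ∈ Ico (0:ℝ) 1, 0 < u r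
  one : u 1 = 0
  zero : u 0 = γ
  hasDerivAt : ∀ r ∈ Ioo (0:ℝ) 1, HasDerivAt u (-(flux lam β u r) / r) r

/-- The extension of a function on `[0, 1]` by its boundary values. -/
def clampExt (u : ℝ → ℝ) (r : ℝ) : ℝ := u (max 0 (min r 1))

theorem clampExt_eq (u : ℝ → ℝ) {r : ℝ} (hr : r ∈ Icc (0:ℝ) 1) : clampExt u r = u r := by
  unfold clampExt
  rw [min_eq_left hr.2, max_eq_right hr.1]

theorem continuous_clampExt {u : ℝ → ℝ} (hu : ContinuousOn u (Icc 0 1)) :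
    Continuous (clampExt u) := by
  apply hu.comp_continuous (by fun_prop)
  intro x
  exact ⟨le_max_left _ _, max_le zero_le_one (min_le_right _ _)⟩

theorem hasDerivAt_linFlux {u : ℝ → ℝ} (hu : Continuous u) (r : ℝ) :
    HasDerivAt (linFlux u) (r * u r) r := by
  have hc : Continuous (fun s : ℝ => s * u s) := by fun_prop
  exact hc.integral_hasStrictDerivAt 0 r |>.hasDerivAt

theorem hasDerivAt_expFlux {u : ℝ → ℝ} (hu : Continuous u) (β r : ℝ) :
    HasDerivAt (expFlux β u) (r * (β * u r * Real.exp ((u r) ^ 2))) r := by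
  have hc : Continuous (fun s : ℝ => s * (β * u s * Real.exp ((u s) ^ 2))) := by fun_prop
  exact hc.integral_hasStrictDerivAt 0 r |>.hasDerivAt

theorem hasDerivAt_flux {u : ℝ → ℝ} (hu : Continuous u) (lam β r : ℝ) :
    HasDerivAt (flux lam β u)
      (r * (lam * u r + β * u r * Real.exp ((u r) ^ 2))) r := by
  have h := (hasDerivAt_expFlux hu β r).add ((hasDerivAt_linFlux hu r).const_mul lam)
  exact h.congr_deriv (by ring)

theorem continuous_linFlux {u : ℝ → ℝ} (hu : Continuous u) : Continuous (linFlux u) :=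
  continuous_iff_continuousAt.2 fun r => (hasDerivAt_linFlux hu r).continuousAt

theorem continuous_expFlux {u : ℝ → ℝ} (hu : Continuous u) (β : ℝ) :
    Continuous (expFlux β u) :=
  continuous_iff_continuousAt.2 fun r => (hasDerivAt_expFlux hu β r).continuousAt

theorem continuous_flux {u : ℝ → ℝ} (hu : Continuous u) (lam β : ℝ) :
    Continuous (flux lam β u) :=
  continuous_iff_continuousAt.2 fun r => (hasDerivAt_flux hu lam β r).continuousAt

@[simp] theorem linFlux_zero (u : ℝ → ℝ) : linFlux u 0 = 0 := by simp [linFlux]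
@[simp] theorem expFlux_zero (β : ℝ) (u : ℝ → ℝ) : expFlux β u 0 = 0 := by simp [expFlux]
@[simp] theorem flux_zero (lam β : ℝ) (u : ℝ → ℝ) : flux lam β u 0 = 0 := by simp [flux]

theorem IsRadSol.radialProfile {lam β γ : ℝ} {u : ℝ → ℝ} (h : IsRadSol lam β γ u)
    (hlam : 0 ≤ lam) (hβ : 0 ≤ β) : RadialProfile lam β γ (clampExt u) := by
  obtain ⟨hs, hode, hpos, h1, h0⟩ := h
  have hc : Continuous (clampExt u) := continuous_clampExt hs.continuousOn
  have hsI : ContDiffOn ℝ (⊤ : ℕ∞) u (Ioo 0 1) := hs.mono Ioo_subset_Icc_self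
  have hd1 : ContDiffOn ℝ 1 (deriv u) (Ioo 0 1) :=
    ((contDiffOn_succ_iff_deriv_of_isOpen isOpen_Ioo).1
      (hsI.of_le (m := 1 + 1) (WithTop.coe_le_coe.2 le_top))).2.2
  have hud : ∀ r ∈ Ioo (0:ℝ) 1, HasDerivAt u (deriv u r) r := fun r hr =>
    ((hsI.differentiableOn (by simp)).differentiableAt (isOpen_Ioo.mem_nhds hr)).hasDerivAt
  have hudd : ∀ r ∈ Ioo (0:ℝ) 1, HasDerivAt (deriv u) (deriv (deriv u) r) r := fun r hr =>
    ((hd1.differentiableOn (by simp)).differentiableAt (isOpen_Ioo.mem_nhds hr)).hasDerivAt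
  set g : ℝ → ℝ := fun r => -(r * deriv u r) - flux lam β (clampExt u) r with hg
  have hgd : ∀ r ∈ Ioo (0:ℝ) 1, HasDerivAt g 0 r := by
    intro r hr
    have e1 := (((hasDerivAt_id r).mul (hudd r hr)).neg).sub
      (hasDerivAt_flux hc lam β r)
    refine e1.congr_deriv ?_
    have := hode r hr
    rw [clampExt_eq u (Ioo_subset_Icc_self hr), ← this]
    unfold radLap
    have : r ≠ 0 := hr.1.ne'
    simp only [id]
    field_simp
    ring
  have hconst : ∀ x ∈ Ioo (0:ℝ) 1, ∀ y ∈ Ioo (0:ℝ) 1, g x = g y := by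
    intro x hx y hy
    apply isOpen_Ioo.is_const_of_deriv_eq_zero isPreconnected_Ioo
      (fun r hr => (hgd r hr).differentiableAt.differentiableWithinAt)
      (fun r hr => (hgd r hr).deriv) hx hy
  have hlim : Tendsto g (𝓝[>] 0) (𝓝 0) := by
    have hdw : ContinuousOn (derivWithin u (Icc 0 1)) (Icc 0 1) :=
      hs.continuousOn_derivWithin (uniqueDiffOn_Icc zero_lt_one) (by simp)
    have h2 : Tendsto (derivWithin u (Icc 0 1)) (𝓝[>] 0) (𝓝 (derivWithin u (Icc 0 1) 0)) := by
      have := (hdw 0 (by simp)).tendsto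
      refine this.mono_left ?_
      rw [← nhdsWithin_Ioo_eq_nhdsGT (zero_lt_one' ℝ)]
      exact nhdsWithin_mono _ Ioo_subset_Icc_self
    have h3 : Tendsto (deriv u) (𝓝[>] 0) (𝓝 (derivWithin u (Icc 0 1) 0)) := by
      refine h2.congr' ?_
      filter_upwards [Ioo_mem_nhdsGT (zero_lt_one' ℝ)] with r hr
      exact derivWithin_of_mem_nhds (Icc_mem_nhds hr.1 hr.2)
    have h4 : Tendsto (fun r : ℝ => r) (𝓝[>] 0) (𝓝 0) := tendsto_id.mono_left nhdsWithin_le_nhds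
    have h5 : Tendsto (flux lam β (clampExt u)) (𝓝[>] 0) (𝓝 (flux lam β (clampExt u) 0)) :=
      ((continuous_flux hc lam β).tendsto 0).mono_left nhdsWithin_le_nhds
    have := ((h4.mul h3).neg).sub h5
    simpa using this
  have hg0 : ∀ r ∈ Ioo (0:ℝ) 1, g r = 0 := by
    intro r hr
    have : Tendsto g (𝓝[>] 0) (𝓝 (g r)) := by
      refine tendsto_const_nhds.congr' ?_
      filter_upwards [Ioo_mem_nhdsGT (zero_lt_one' ℝ)] with s hs
      exact hconst r hr s hs
    exact tendsto_nhds_unique this hlim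
  refine ⟨hlam, hβ, hc, ?_, ?_, ?_, ?_⟩
  · intro r hr
    rw [clampExt_eq u (Ico_subset_Icc_self hr)]
    exact hpos r hr
  · rw [clampExt_eq u (by simp), h1]
  · rw [clampExt_eq u (by simp), h0]
  · intro r hr
    have e : -(flux lam β (clampExt u) r) / r = deriv u r := by
      have := hg0 r hr
      have hr0 : r ≠ 0 := hr.1.ne'
      simp only [hg] at this
      field_simp
      linarith
    rw [e]
    refine (hud r hr).congr_of_eventuallyEq ?_
    filter_upwards [Icc_mem_nhds hr.1 hr.2] with s hs
    exact clampExt_eq u hs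

theorem monotoneOn_Icc_of_hasDerivAt {f f' : ℝ → ℝ} {a b : ℝ} (hf : ContinuousOn f (Icc a b))
    (h : ∀ x ∈ Ioo a b, HasDerivAt f (f' x) x) (h0 : ∀ x ∈ Ioo a b, 0 ≤ f' x) :
    MonotoneOn f (Icc a b) := by
  apply monotoneOn_of_deriv_nonneg (convex_Icc a b) hf
  · rw [interior_Icc]
    exact fun x hx => (h x hx).differentiableAt.differentiableWithinAt
  · rw [interior_Icc]
    intro x hx
    rw [(h x hx).deriv]
    exact h0 x hx

theorem le_of_hasDerivAt_nonneg {f f' : ℝ → ℝ} {a b : ℝ} (hab : a ≤ b)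
    (hf : ContinuousOn f (Icc a b))
    (h : ∀ x ∈ Ioo a b, HasDerivAt f (f' x) x) (h0 : ∀ x ∈ Ioo a b, 0 ≤ f' x) :
    f a ≤ f b :=
  monotoneOn_Icc_of_hasDerivAt hf h h0 ⟨le_rfl, hab⟩ ⟨hab, le_rfl⟩ hab

namespace RadialProfile

variable {lam β γ : ℝ} {u : ℝ → ℝ}

theorem nonneg (P : RadialProfile lam β γ u) {r : ℝ} (hr : r ∈ Icc (0:ℝ) 1) : 0 ≤ u r := by
  rcases hr.2.lt_or_eq with h | h
  · exact (P.pos r ⟨hr.1, h⟩).le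
  · rw [h, P.one]

theorem center_pos (P : RadialProfile lam β γ u) : 0 < γ := P.zero ▸ P.pos 0 (by simp)

theorem monotoneOn_linFlux (P : RadialProfile lam β γ u) :
    MonotoneOn (linFlux u) (Icc 0 1) := by
  refine monotoneOn_Icc_of_hasDerivAt (continuous_linFlux P.cont).continuousOn
    (fun x _ => hasDerivAt_linFlux P.cont x) fun x hx => ?_
  exact mul_nonneg hx.1.le (P.nonneg (Ioo_subset_Icc_self hx))

theorem monotoneOn_expFlux (P : RadialProfile lam β γ u) :
    MonotoneOn (expFlux β u) (Icc 0 1) := by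
  refine monotoneOn_Icc_of_hasDerivAt (continuous_expFlux P.cont β).continuousOn
    (fun x _ => hasDerivAt_expFlux P.cont β x) fun x hx => ?_
  have := P.nonneg (Ioo_subset_Icc_self hx)
  have := P.beta_nonneg
  have := hx.1.le
  positivity

theorem linFlux_nonneg (P : RadialProfile lam β γ u) {r : ℝ} (hr : r ∈ Icc (0:ℝ) 1) :
    0 ≤ linFlux u r := by
  simpa using P.monotoneOn_linFlux (by simp) hr hr.1

theorem expFlux_nonneg (P : RadialProfile lam β γ u) {r : ℝ} (hr : r ∈ Icc (0:ℝ) 1) :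
    0 ≤ expFlux β u r := by
  simpa using P.monotoneOn_expFlux (by simp) hr hr.1

theorem expFlux_le_flux (P : RadialProfile lam β γ u) {r : ℝ} (hr : r ∈ Icc (0:ℝ) 1) :
    expFlux β u r ≤ flux lam β u r := by
  have := mul_nonneg P.lam_nonneg (P.linFlux_nonneg hr)
  unfold flux
  linarith

theorem flux_nonneg (P : RadialProfile lam β γ u) {r : ℝ} (hr : r ∈ Icc (0:ℝ) 1) :
    0 ≤ flux lam β u r := (P.expFlux_nonneg hr).trans (P.expFlux_le_flux hr)

theorem antitoneOn (P : RadialProfile lam β γ u) : AntitoneOn u (Icc 0 1) := by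
  have : MonotoneOn (fun x => -u x) (Icc 0 1) := by
    refine monotoneOn_Icc_of_hasDerivAt P.cont.neg.continuousOn
      (fun x hx => (P.hasDerivAt x hx).neg) fun x hx => ?_
    have := P.flux_nonneg (Ioo_subset_Icc_self hx)
    have h2 := div_nonneg this hx.1.le
    rw [neg_div]
    linarith
  intro a ha b hb hab
  have := this ha hb hab
  simp only at this
  linarith

theorem le_center (P : RadialProfile lam β γ u) {r : ℝ} (hr : r ∈ Icc (0:ℝ) 1) : u r ≤ γ := by
  rw [← P.zero]
  exact P.antitoneOn (by simp) hr hr.1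

theorem drop_le (P : RadialProfile lam β γ u) {a b K k : ℝ} (ha : 0 < a) (hab : a ≤ b)
    (hb : b ≤ 1) (h : ∀ s ∈ Ioo a b, flux lam β u s ≤ K + k * s) :
    u a - u b ≤ K * (log b - log a) + k * (b - a) := by
  have key := le_of_hasDerivAt_nonneg (f := fun s => u s + K * log s + k * s)
    (f' := fun s => -(flux lam β u s) / s + K * s⁻¹ + k) hab ?_ ?_ ?_
  · linarith
  · refine (P.cont.continuousOn.add (continuousOn_const.mul (continuousOn_log.mono ?_))).add
      (by fun_prop)
    intro x hx
    exact (ha.trans_le hx.1).ne'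
  · intro x hx
    have hx0 : 0 < x := ha.trans hx.1
    have := ((P.hasDerivAt x ⟨hx0, hx.2.trans_le hb⟩).add
      ((Real.hasDerivAt_log hx0.ne').const_mul K)).add ((hasDerivAt_id x).const_mul k)
    exact this.congr_deriv (by ring)
  · intro x hx
    have hx0 : 0 < x := ha.trans hx.1
    have := h x hx
    have e : -(flux lam β u x) / x + K * x⁻¹ + k = (K + k * x - flux lam β u x) / x := by
      field_simp
      ring
    rw [e]
    exact div_nonneg (by linarith) hx0.le

theorem le_drop (P : RadialProfile lam β γ u) {a b K : ℝ} (ha : 0 < a) (hab : a ≤ b)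
    (hb : b ≤ 1) (h : ∀ s ∈ Ioo a b, K ≤ flux lam β u s) :
    K * (log b - log a) ≤ u a - u b := by
  have key := le_of_hasDerivAt_nonneg (f := fun s => -(u s + K * log s))
    (f' := fun s => -(-(flux lam β u s) / s + K * s⁻¹)) hab ?_ ?_ ?_
  · linarith
  · refine (P.cont.continuousOn.add (continuousOn_const.mul (continuousOn_log.mono ?_))).neg
    intro x hx
    exact (ha.trans_le hx.1).ne'
  · intro x hx
    have hx0 : 0 < x := ha.trans hx.1
    exact ((P.hasDerivAt x ⟨hx0, hx.2.trans_le hb⟩).add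
      ((Real.hasDerivAt_log hx0.ne').const_mul K)).neg
  · intro x hx
    have hx0 : 0 < x := ha.trans hx.1
    have := h x hx
    have e : -(-(flux lam β u x) / x + K * x⁻¹) = (flux lam β u x - K) / x := by
      field_simp
      ring
    rw [e]
    exact div_nonneg (by linarith) hx0.le

theorem drop_center_le (P : RadialProfile lam β γ u) {b k : ℝ} (hb0 : 0 ≤ b) (hb : b ≤ 1)
    (h : ∀ s ∈ Ioo 0 b, flux lam β u s ≤ k * s ^ 2) :
    γ - u b ≤ k * b ^ 2 / 2 := by
  have key := le_of_hasDerivAt_nonneg (f := fun s => u s + k * s ^ 2 / 2)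
    (f' := fun s => -(flux lam β u s) / s + k * s) hb0 ?_ ?_ ?_
  · simp only [P.zero] at key
    linarith
  · exact (P.cont.add (by fun_prop)).continuousOn
  · intro x hx
    have := (P.hasDerivAt x ⟨hx.1, hx.2.trans_le hb⟩).add
      ((((hasDerivAt_id x).pow 2).const_mul k).div_const 2)
    exact this.congr_deriv (by simp; ring)
  · intro x hx
    have hx0 := hx.1
    have := h x hx
    have e : -(flux lam β u x) / x + k * x = (k * x ^ 2 - flux lam β u x) / x := by
      field_simp
      ring
    rw [e]
    exact div_nonneg (by linarith) hx0.le

theorem exists_eq (P : RadialProfile lam β γ u) {c : ℝ} (h0 : 0 ≤ c) (hc : c ≤ γ) :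
    ∃ r ∈ Icc (0:ℝ) 1, u r = c := by
  have := intermediate_value_Icc' (zero_le_one' ℝ) P.cont.continuousOn
  rw [P.one, P.zero] at this
  exact this ⟨h0, hc⟩

theorem linFlux_le (P : RadialProfile lam β γ u) {r : ℝ} (hr : r ∈ Icc (0:ℝ) 1) :
    linFlux u r ≤ γ * r ^ 2 / 2 := by
  have key := le_of_hasDerivAt_nonneg (f := fun s => γ * s ^ 2 / 2 - linFlux u s)
    (f' := fun s => γ * s - s * u s) hr.1 ?_ ?_ ?_
  · simp only [linFlux_zero] at key
    linarith
  · have := continuous_linFlux P.cont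
    fun_prop
  · intro x hx
    have := ((((hasDerivAt_id x).pow 2).const_mul γ).div_const 2).sub
      (hasDerivAt_linFlux P.cont x)
    exact this.congr_deriv (by simp; ring)
  · intro x hx
    have := P.le_center ⟨hx.1.le, hx.2.le.trans hr.2⟩
    nlinarith [hx.1]

theorem expFlux_le (P : RadialProfile lam β γ u) {r : ℝ} (hr : r ∈ Icc (0:ℝ) 1) :
    expFlux β u r ≤ β * γ * exp (γ ^ 2) * r ^ 2 / 2 := by
  have key := le_of_hasDerivAt_nonneg
    (f := fun s => β * γ * exp (γ ^ 2) * s ^ 2 / 2 - expFlux β u s)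
    (f' := fun s => β * γ * exp (γ ^ 2) * s - s * (β * u s * exp ((u s) ^ 2))) hr.1 ?_ ?_ ?_
  · simp only [expFlux_zero] at key
    linarith
  · have := continuous_expFlux P.cont β
    fun_prop
  · intro x hx
    have := ((((hasDerivAt_id x).pow 2).const_mul (β * γ * exp (γ ^ 2))).div_const 2).sub
      (hasDerivAt_expFlux P.cont β x)
    exact this.congr_deriv (by simp; ring)
  · intro x hx
    have hx' : x ∈ Icc (0:ℝ) 1 := ⟨hx.1.le, hx.2.le.trans hr.2⟩
    have h1 := P.le_center hx'
    have h2 := P.nonneg hx'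
    have h3 := P.beta_nonneg
    have h5 := P.center_pos.le
    have h4 : β * u x * exp ((u x) ^ 2) ≤ β * γ * exp (γ ^ 2) := by gcongr
    nlinarith [hx.1]

/-- `r` times the derivative of `expFlux`. -/
theorem hasDerivAt_density (P : RadialProfile lam β γ u) {r : ℝ} (hr : r ∈ Ioo (0:ℝ) 1) :
    HasDerivAt (fun s => β * s ^ 2 * u s * exp ((u s) ^ 2))
      (r * (β * u r * exp ((u r) ^ 2)) * 2
        - flux lam β u r * (r * (β * exp ((u r) ^ 2)) * (1 + 2 * u r ^ 2))) r := by
  have hu := P.hasDerivAt r hr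
  have := ((((hasDerivAt_id r).pow 2).const_mul β).mul hu).mul ((hu.pow 2).exp)
  refine this.congr_deriv ?_
  have : r ≠ 0 := hr.1.ne'
  simp
  field_simp
  ring

theorem density_le (P : RadialProfile lam β γ u) {r : ℝ} (hr : r ∈ Icc (0:ℝ) 1) :
    β * r ^ 2 * u r * exp ((u r) ^ 2) ≤ expFlux β u r * (2 - u r * expFlux β u r) := by
  have hcu := P.cont
  have hcB := continuous_expFlux P.cont β
  have key := le_of_hasDerivAt_nonneg
    (f := fun s => 2 * expFlux β u s - u r * (expFlux β u s) ^ 2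
      - β * s ^ 2 * u s * exp ((u s) ^ 2))
    (f' := fun s => s * (β * exp ((u s) ^ 2)) *
      (flux lam β u s * (1 + 2 * u s ^ 2) - 2 * u r * u s * expFlux β u s)) hr.1 ?_ ?_ ?_
  · simp only [expFlux_zero] at key
    linarith
  · fun_prop
  · intro x hx
    have hB := hasDerivAt_expFlux P.cont β x
    have := ((hB.const_mul 2).sub ((hB.pow 2).const_mul (u r))).sub
      (P.hasDerivAt_density ⟨hx.1, hx.2.trans_le hr.2⟩)
    refine this.congr_deriv ?_
    simp
    ring
  · intro x hx
    have hx' : x ∈ Icc (0:ℝ) 1 := ⟨hx.1.le, hx.2.le.trans hr.2⟩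
    have h1 := P.antitoneOn hx' hr hx.2.le
    have h2 := P.nonneg hr
    have h3 := P.beta_nonneg
    have h4 := P.expFlux_le_flux hx'
    have h5 := P.expFlux_nonneg hx'
    have h6 := hx.1.le
    refine mul_nonneg (by positivity) ?_
    have h7 : u r * u x ≤ u x ^ 2 := by nlinarith
    have h8 : u r * u x * expFlux β u x ≤ u x ^ 2 * flux lam β u x := by gcongr
    nlinarith [h5.trans h4]

theorem mul_expFlux_le_two (P : RadialProfile lam β γ u) {r : ℝ} (hr : r ∈ Icc (0:ℝ) 1) :
    u r * expFlux β u r ≤ 2 := by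
  by_contra! h
  have h1 := P.density_le hr
  have h2 := P.nonneg hr
  have h3 := P.expFlux_nonneg hr
  have h4 := P.beta_nonneg
  have h5 : 0 ≤ β * r ^ 2 * u r * exp ((u r) ^ 2) := by positivity
  have h6 : expFlux β u r = 0 := by nlinarith
  rw [h6] at h
  linarith

end RadialProfile

theorem RadialProfile.le_expFlux {lam β γ : ℝ} {u : ℝ → ℝ} (P : RadialProfile lam β γ u)
    {r : ℝ} (hr : r ∈ Icc (0:ℝ) 1) :
    β * u r * exp ((u r) ^ 2) * r ^ 2 / 2 ≤ expFlux β u r := by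
  have key := le_of_hasDerivAt_nonneg
    (f := fun s => expFlux β u s - β * u r * exp ((u r) ^ 2) * s ^ 2 / 2)
    (f' := fun s => s * (β * u s * exp ((u s) ^ 2)) - β * u r * exp ((u r) ^ 2) * s)
    hr.1 ?_ ?_ ?_
  · simp only [expFlux_zero] at key
    linarith
  · have := continuous_expFlux P.cont β
    fun_prop
  · intro x hx
    have := (hasDerivAt_expFlux P.cont β x).sub
      ((((hasDerivAt_id x).pow 2).const_mul (β * u r * exp ((u r) ^ 2))).div_const 2)
    exact this.congr_deriv (by simp; ring)
  · intro x hx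
    have hx' : x ∈ Icc (0:ℝ) 1 := ⟨hx.1.le, hx.2.le.trans hr.2⟩
    have h1 := P.antitoneOn hx' hr hx.2.le
    have h2 := P.nonneg hr
    have h3 := P.beta_nonneg
    have h5 := h2.trans h1
    have h4 : β * u r * exp ((u r) ^ 2) ≤ β * u x * exp ((u x) ^ 2) := by gcongr
    nlinarith [hx.1]

theorem RadialProfile.drop_center_le_sq {lam β γ : ℝ} {u : ℝ → ℝ} (P : RadialProfile lam β γ u)
    (hlam : lam ≤ γ) {r : ℝ} (hr : r ∈ Icc (0:ℝ) 1) :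
    γ - u r ≤ (β * γ * exp (γ ^ 2) + γ ^ 2) * r ^ 2 / 4 := by
  have h := P.drop_center_le (b := r) (k := β * γ * exp (γ ^ 2) / 2 + γ ^ 2 / 2) hr.1 hr.2 (by
    intro s hs
    have hs' : s ∈ Icc (0:ℝ) 1 := ⟨hs.1.le, hs.2.le.trans hr.2⟩
    have h1 := P.expFlux_le hs'
    have h2 := P.linFlux_le hs'
    have h3 := P.linFlux_nonneg hs'
    have h4 : lam * linFlux u s ≤ γ * (γ * s ^ 2 / 2) := by
      have := P.center_pos
      gcongr
    unfold flux
    nlinarith)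
  linarith

/-- A radial solution concentrating at scale `μ ≤ γ⁻⁵⁰`, with `γ` large. -/
structure Bubble (lam β γ μ : ℝ) (u : ℝ → ℝ) : Prop extends RadialProfile lam β γ u where
  beta_pos : 0 < β
  scale_pos : 0 < μ
  scale_eq : β * γ ^ 2 * exp (γ ^ 2) * μ ^ 2 = 4
  lam_le : lam ≤ γ
  scale_le : μ * γ ^ 50 ≤ 1
  large : 10 ^ 6 ≤ γ
  log_le : 10 ^ 6 * log γ ≤ γ

namespace Bubble

variable {lam β γ μ : ℝ} {u : ℝ → ℝ}

theorem one_le_log (D : Bubble lam β γ μ u) : 1 ≤ log γ := by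
  rw [le_log_iff_exp_le (by linarith [D.large])]
  have := exp_one_lt_d9
  linarith [D.large]

theorem scale_mul_pow_le (D : Bubble lam β γ μ u) : μ * γ ^ 6 ≤ (γ ^ 14)⁻¹ := by
  have hγ : 0 < γ := by linarith [D.large]
  rw [le_inv_comm₀ (by have := D.scale_pos; positivity) (by positivity), ← one_div,
    le_div_iff₀ (by have := D.scale_pos; positivity)]
  calc γ ^ 14 * (μ * γ ^ 6) = μ * γ ^ 20 := by ring
    _ ≤ μ * γ ^ 50 := by
        have := D.scale_pos
        gcongr
        · linarith [D.large]
        · norm_num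
    _ ≤ 1 := D.scale_le

theorem scale_mul_pow_le_one (D : Bubble lam β γ μ u) : μ * γ ^ 6 ≤ 1 :=
  D.scale_mul_pow_le.trans (inv_le_one_of_one_le₀ (one_le_pow₀ (by linarith [D.large])))

theorem scale_mul_le (D : Bubble lam β γ μ u) : μ * γ ≤ μ * γ ^ 6 := by
  have h1 : 1 ≤ γ := by linarith [D.large]
  have := D.scale_pos
  gcongr
  exact le_self_pow₀ h1 (by norm_num)

theorem scale_le_scale_mul (D : Bubble lam β γ μ u) : μ ≤ μ * γ :=
  le_mul_of_one_le_right D.scale_pos.le (by linarith [D.large])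

theorem lam_mul_linFlux_le (D : Bubble lam β γ μ u) {r : ℝ} (h0 : 0 ≤ r) (hr : r ≤ μ * γ ^ 6) :
    lam * linFlux u r ≤ (γ ^ 4)⁻¹ := by
  have hγ : 0 < γ := by linarith [D.large]
  have h1 := D.linFlux_le ⟨h0, hr.trans D.scale_mul_pow_le_one⟩
  have h2 := D.linFlux_nonneg ⟨h0, hr.trans D.scale_mul_pow_le_one⟩
  have h3 : r ≤ (γ ^ 14)⁻¹ := hr.trans D.scale_mul_pow_le
  calc lam * linFlux u r ≤ γ * (γ * r ^ 2 / 2) := by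
        have := D.lam_le
        gcongr
    _ ≤ γ * (γ * ((γ ^ 14)⁻¹) ^ 2 / 2) := by gcongr
    _ = (γ ^ 26)⁻¹ / 2 := by field_simp
    _ ≤ (γ ^ 26)⁻¹ := by linarith [show 0 < (γ ^ 26)⁻¹ by positivity]
    _ ≤ (γ ^ 4)⁻¹ := by
        gcongr
        · linarith [D.large]
        · norm_num

theorem sub_le_at_scale (D : Bubble lam β γ μ u) : γ - 2 / γ ≤ u μ := by
  have hγ : 0 < γ := by linarith [D.large]
  have hμ1 : μ ≤ 1 := D.scale_le_scale_mul.trans (D.scale_mul_le.trans D.scale_mul_pow_le_one)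
  have h := D.drop_center_le_sq D.lam_le ⟨D.scale_pos.le, hμ1⟩
  have e : β * γ * exp (γ ^ 2) * μ ^ 2 = 4 / γ := by
    rw [eq_div_iff hγ.ne', ← D.scale_eq]
    ring
  have h3 : μ ≤ (γ ^ 14)⁻¹ :=
    D.scale_le_scale_mul.trans (D.scale_mul_le.trans D.scale_mul_pow_le)
  have h4 : γ ^ 2 * μ ^ 2 ≤ 1 / γ := by
    calc γ ^ 2 * μ ^ 2 ≤ γ ^ 2 * ((γ ^ 14)⁻¹) ^ 2 := by
          have := D.scale_pos
          gcongr
      _ = (γ ^ 26)⁻¹ := by field_simp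
      _ ≤ (γ ^ 1)⁻¹ := by
        gcongr
        · linarith [D.large]
        · norm_num
      _ = 1 / γ := by simp
  have e2 : (β * γ * exp (γ ^ 2) + γ ^ 2) * μ ^ 2 / 4 ≤ 2 / γ := by
    have h5 : 4 / γ = 4 * (1 / γ) := by ring
    have h6 : 2 / γ = 2 * (1 / γ) := by ring
    have h7 : 0 < 1 / γ := by positivity
    nlinarith
  linarith

theorem inv_expFlux_scale_le (D : Bubble lam β γ μ u) :
    0 < expFlux β u μ ∧ (expFlux β u μ)⁻¹ ≤ 55 * γ := by
  have hγ : 0 < γ := by linarith [D.large]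
  have hμ1 : μ ≤ 1 := D.scale_le_scale_mul.trans (D.scale_mul_le.trans D.scale_mul_pow_le_one)
  have hμ0 := D.scale_pos
  have h := D.le_expFlux ⟨D.scale_pos.le, hμ1⟩
  have h1 := D.sub_le_at_scale
  have h2 : 2 / γ ≤ γ / 2 := by
    rw [div_le_iff₀ hγ]
    nlinarith [D.large]
  have h3 : γ ^ 2 - 4 ≤ (u μ) ^ 2 := by
    have : (γ - 2 / γ) ^ 2 ≤ (u μ) ^ 2 := by
      apply pow_le_pow_left₀ _ h1
      linarith
    have e : (γ - 2 / γ) ^ 2 = γ ^ 2 - 4 + (2 / γ) ^ 2 := by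
      field_simp
      ring
    nlinarith [sq_nonneg (2 / γ)]
  have h4 : exp 4 ≤ 55 := by
    have : exp 4 = (exp 1) ^ 4 := by rw [← exp_nat_mul]; norm_num
    rw [this]
    calc (exp 1) ^ 4 ≤ 2.7182818286 ^ 4 := by
          gcongr
          exact exp_one_lt_d9.le
      _ ≤ 55 := by norm_num
  have h5 : 1 / (55 * γ) ≤ expFlux β u μ := by
    refine le_trans ?_ h
    calc 1 / (55 * γ) ≤ exp (-4) / γ := by
          rw [exp_neg, div_le_div_iff₀ (by positivity) hγ]
          have : (55:ℝ)⁻¹ ≤ (exp 4)⁻¹ := by gcongr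
          nlinarith
      _ = β * (γ / 2) * exp (γ ^ 2 - 4) * μ ^ 2 / 2 := by
          rw [sub_eq_add_neg, exp_add, div_eq_iff hγ.ne']
          have := D.scale_eq
          linear_combination (- exp (-4) / 4) * this
      _ ≤ _ := by
          have := D.beta_pos
          have : 0 ≤ u μ := by linarith
          gcongr
          linarith
  have h6 : 0 < expFlux β u μ := lt_of_lt_of_le (by positivity) h5
  refine ⟨h6, ?_⟩
  rw [inv_le_comm₀ h6 (by positivity), ← one_div]
  exact h5

theorem expFlux_pos (D : Bubble lam β γ μ u) {r : ℝ} (h0 : μ ≤ r) (h1 : r ≤ 1) :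
    0 < expFlux β u r :=
  D.inv_expFlux_scale_le.1.trans_le
    (D.monotoneOn_expFlux ⟨D.scale_pos.le, h0.trans h1⟩ ⟨D.scale_pos.le.trans h0, h1⟩ h0)

theorem sub_le_of_half_le (D : Bubble lam β γ μ u) {r : ℝ} (h0 : μ ≤ r) (h1 : r ≤ μ * γ ^ 6)
    (hu : γ / 2 ≤ u r) : γ - 40 * log γ / γ ≤ u r := by
  have hγ : 0 < γ := by linarith [D.large]
  have hr1 : r ≤ 1 := h1.trans D.scale_mul_pow_le_one
  have hd := D.drop_le (a := μ) (b := r) (K := 5 / γ) (k := 0) D.scale_pos h0 hr1 (by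
    intro s hs
    have hs0 : 0 ≤ s := D.scale_pos.le.trans hs.1.le
    have hs' : s ∈ Icc (0:ℝ) 1 := ⟨hs0, hs.2.le.trans hr1⟩
    have h2 := D.mul_expFlux_le_two hs'
    have h3 := D.antitoneOn hs' ⟨D.scale_pos.le.trans h0, hr1⟩ hs.2.le
    have h4 := D.lam_mul_linFlux_le hs0 (hs.2.le.trans h1)
    have h5 : expFlux β u s ≤ 4 / γ := by
      rw [le_div_iff₀ hγ]
      nlinarith [D.expFlux_nonneg hs']
    have h6 : (γ ^ 4)⁻¹ ≤ 1 / γ := by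
      rw [← one_div]
      gcongr
      exact le_self_pow₀ (by linarith [D.large]) (by norm_num)
    have h7 : 4 / γ + 1 / γ = 5 / γ := by ring
    unfold flux
    linarith)
  have hl : log r - log μ ≤ 6 * log γ := by
    have : log r ≤ log (μ * γ ^ 6) := log_le_log (D.scale_pos.trans_le h0) h1
    rw [log_mul D.scale_pos.ne' (by positivity), log_pow] at this
    push_cast at this
    linarith
  have h8 := D.sub_le_at_scale
  have h9 : 5 / γ * (log r - log μ) ≤ 5 / γ * (6 * log γ) := by gcongr
  have h10 : 2 / γ + 5 / γ * (6 * log γ) ≤ 40 * log γ / γ := by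
    rw [le_div_iff₀ hγ]
    field_simp
    linarith [D.one_le_log]
  linarith

theorem sub_le (D : Bubble lam β γ μ u) {r : ℝ} (h0 : μ ≤ r) (h1 : r ≤ μ * γ ^ 6) :
    γ - 40 * log γ / γ ≤ u r := by
  have hγ : 0 < γ := by linarith [D.large]
  have hr1 : r ≤ 1 := h1.trans D.scale_mul_pow_le_one
  have hr0 := D.scale_pos.le.trans h0
  have hl : 40 * log γ / γ ≤ 1 := by
    rw [div_le_one hγ]
    linarith [D.log_le, D.one_le_log]
  have h2γ : 2 / γ ≤ 1 := by
    rw [div_le_one hγ]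
    linarith [D.large]
  refine D.sub_le_of_half_le h0 h1 ?_
  by_contra! h
  obtain ⟨s, hs, hus⟩ := D.exists_eq (c := γ / 2) (by linarith) (by linarith)
  have hsr : s ≤ r := by
    by_contra! hc
    have := D.antitoneOn ⟨hr0, hr1⟩ hs hc.le
    linarith
  have hμs : μ ≤ s := by
    by_contra! hc
    have := D.antitoneOn hs ⟨D.scale_pos.le, h0.trans hr1⟩ hc.le
    have := D.sub_le_at_scale
    linarith [D.large]
  have := D.sub_le_of_half_le hμs (hsr.trans h1) hus.ge
  linarith [D.large]

theorem mul_le_density (D : Bubble lam β γ μ u) {r : ℝ} (h0 : 0 ≤ r) (h1 : r ≤ μ * γ) :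
    expFlux β u r * (2 - 2 * (γ + 1 / (2 * γ)) * (γ ^ 4)⁻¹ - (γ + 1 / (2 * γ)) * expFlux β u r)
      ≤ β * r ^ 2 * u r * exp ((u r) ^ 2) := by
  have hγ : 0 < γ := by linarith [D.large]
  have hr1 : r ≤ 1 := h1.trans (D.scale_mul_le.trans D.scale_mul_pow_le_one)
  set κ := γ + 1 / (2 * γ) with hκ
  have hcu := D.cont
  have hcB := continuous_expFlux D.cont β
  have key := le_of_hasDerivAt_nonneg
    (f := fun s => β * s ^ 2 * u s * exp ((u s) ^ 2) - 2 * expFlux β u s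
      + κ * ((expFlux β u s) ^ 2 + 2 * (γ ^ 4)⁻¹ * expFlux β u s))
    (f' := fun s => s * (β * exp ((u s) ^ 2)) *
      (2 * κ * u s * (expFlux β u s + (γ ^ 4)⁻¹) - flux lam β u s * (1 + 2 * u s ^ 2))) h0 ?_ ?_ ?_
  · simp only [expFlux_zero] at key
    linarith
  · fun_prop
  · intro x hx
    have hB := hasDerivAt_expFlux D.cont β x
    have := ((D.hasDerivAt_density ⟨hx.1, hx.2.trans_le hr1⟩).sub (hB.const_mul 2)).add
      (((hB.pow 2).add (hB.const_mul (2 * (γ ^ 4)⁻¹))).const_mul κ)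
    refine this.congr_deriv ?_
    simp
    ring
  · intro x hx
    have hx' : x ∈ Icc (0:ℝ) 1 := ⟨hx.1.le, hx.2.le.trans hr1⟩
    have hx1 : x ≤ μ * γ := hx.2.le.trans h1
    have h2 := D.le_center hx'
    have h3 := D.lam_mul_linFlux_le hx.1.le (hx1.trans D.scale_mul_le)
    have h4 : 1 ≤ u x := by
      have := D.sub_le D.scale_le_scale_mul D.scale_mul_le
      have h5 := D.antitoneOn hx' ⟨(mul_pos D.scale_pos hγ).le,
        D.scale_mul_le.trans D.scale_mul_pow_le_one⟩ hx1
      have hl : 40 * log γ / γ ≤ 1 := by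
        rw [div_le_one hγ]
        linarith [D.log_le, D.one_le_log]
      linarith [D.large]
    have h5 := D.expFlux_nonneg hx'
    have h6 := D.beta_pos.le
    have h7 : flux lam β u x ≤ expFlux β u x + (γ ^ 4)⁻¹ := by
      unfold flux
      linarith
    have h8 : 1 + 2 * u x ^ 2 ≤ 2 * κ * u x := by
      have e : 2 * κ * u x - (1 + 2 * u x ^ 2) = (γ - u x) * (2 * u x - 1 / γ) := by
        rw [hκ]
        field_simp
        ring
      have : 1 / γ ≤ 1 := by
        rw [div_le_one hγ]
        linarith [D.large]
      nlinarith [mul_nonneg (sub_nonneg.2 h2) (by linarith : (0:ℝ) ≤ 2 * u x - 1 / γ)]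
    have hxx := hx.1.le
    refine mul_nonneg (by positivity) ?_
    have h9 : flux lam β u x * (1 + 2 * u x ^ 2)
        ≤ (expFlux β u x + (γ ^ 4)⁻¹) * (2 * κ * u x) := by
      gcongr
    linarith

theorem inv_expFlux_le (D : Bubble lam β γ μ u) {r : ℝ} (h0 : μ * γ ≤ r) (h1 : r ≤ 1) :
    (expFlux β u r)⁻¹ ≤ γ / 2 + 60 / γ := by
  have hγ : 0 < γ := by linarith [D.large]
  have hμ0 := D.scale_pos
  have hle := D.scale_le_scale_mul
  have hR1 := h0.trans h1
  have hpos : ∀ s ∈ Icc μ (μ * γ), 0 < expFlux β u s := fun s hs =>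
    D.expFlux_pos hs.1 (hs.2.trans hR1)
  have hcB := continuous_expFlux D.cont β
  set κ := γ + 1 / (2 * γ) with hκ
  have hκ1 : κ ≤ 2 * γ := by
    have : 1 / (2 * γ) ≤ γ := by
      rw [div_le_iff₀ (by positivity)]
      nlinarith [D.large]
    linarith
  have hκ0 : 0 < κ := by positivity
  set κ' := κ + 2 * κ * (γ ^ 4)⁻¹ * (55 * γ) with hκ'
  have key := le_of_hasDerivAt_nonneg
    (f := fun s => κ' * s ^ 2 / 2 - s ^ 2 * (expFlux β u s)⁻¹)
    (f' := fun s => κ' * s - (2 * s * (expFlux β u s)⁻¹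
      + s ^ 2 * (-(s * (β * u s * exp ((u s) ^ 2))) / (expFlux β u s) ^ 2))) hle ?_ ?_ ?_
  · have hy := D.inv_expFlux_scale_le.2
    have h2 : (expFlux β u r)⁻¹ ≤ (expFlux β u (μ * γ))⁻¹ := by
      apply inv_anti₀ (hpos _ ⟨hle, le_rfl⟩)
      exact D.monotoneOn_expFlux ⟨by positivity, hR1⟩ ⟨(by positivity : 0 ≤ μ * γ).trans h0, h1⟩ h0
    refine h2.trans ?_
    have h3 : (μ * γ) ^ 2 * (expFlux β u (μ * γ))⁻¹
        ≤ (μ * γ) ^ 2 * (κ' / 2 + (55 * γ) / γ ^ 2) := by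
      have e : (μ * γ) ^ 2 * (κ' / 2 + (55 * γ) / γ ^ 2)
        = κ' * (μ * γ) ^ 2 / 2 + μ ^ 2 * (55 * γ) := by field_simp
      rw [e]
      have h4 : μ ^ 2 * (expFlux β u μ)⁻¹ ≤ μ ^ 2 * (55 * γ) := by gcongr
      have h5 : 0 ≤ κ' * μ ^ 2 / 2 := by positivity
      linarith
    have h4 := le_of_mul_le_mul_left h3 (by positivity)
    refine h4.trans ?_
    have h5 : 2 * κ * (γ ^ 4)⁻¹ * (55 * γ) ≤ 2 / γ := by
      calc 2 * κ * (γ ^ 4)⁻¹ * (55 * γ) ≤ 2 * (2 * γ) * (γ ^ 4)⁻¹ * (55 * γ) := by gcongr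
        _ = (220 / γ) / γ := by
            field_simp
            norm_num
        _ ≤ 2 / γ := by
            gcongr
            rw [div_le_iff₀ hγ]
            linarith [D.large]
    have e1 : 55 * γ / γ ^ 2 = 55 * (1 / γ) := by field_simp
    have e2 : 60 / γ = 60 * (1 / γ) := by ring
    have e3 : 1 / (2 * γ) = (1 / 2) * (1 / γ) := by field_simp
    have e4 : 2 / γ = 2 * (1 / γ) := by ring
    have : 0 < 1 / γ := by positivity
    rw [e1, e2, hκ', hκ]
    rw [hκ] at h5
    linarith
  · refine ContinuousOn.sub (by fun_prop) (ContinuousOn.mul (by fun_prop) ?_)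
    exact hcB.continuousOn.inv₀ fun s hs => (hpos s hs).ne'
  · intro s hs
    have hB := hasDerivAt_expFlux D.cont β s
    have hs' := hpos s (Ioo_subset_Icc_self hs)
    have := ((((hasDerivAt_id s).pow 2).const_mul κ').div_const 2).sub
      (((hasDerivAt_id s).pow 2).mul (hB.inv hs'.ne'))
    refine this.congr_deriv ?_
    simp
    ring
  · intro s hs
    have hs' := hpos s (Ioo_subset_Icc_self hs)
    have hs0 : 0 < s := hμ0.trans hs.1
    have h2 := D.mul_le_density hs0.le hs.2.le
    rw [← hκ] at h2
    have h3 : (expFlux β u s)⁻¹ ≤ 55 * γ := by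
      refine le_trans ?_ D.inv_expFlux_scale_le.2
      apply inv_anti₀ D.inv_expFlux_scale_le.1
      exact D.monotoneOn_expFlux ⟨hμ0.le, hle.trans hR1⟩ ⟨hs0.le, hs.2.le.trans hR1⟩ hs.1.le
    set B := expFlux β u s with hB
    have e : κ' * s - (2 * s * B⁻¹ + s ^ 2 * (-(s * (β * u s * exp ((u s) ^ 2))) / B ^ 2))
        = s * (κ' - κ - 2 * κ * (γ ^ 4)⁻¹ * B⁻¹) + s * (β * s ^ 2 * u s * exp ((u s) ^ 2)
          - B * (2 - 2 * κ * (γ ^ 4)⁻¹ - κ * B)) / B ^ 2 := by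
      field_simp
      ring
    rw [e]
    have h4 : 2 * κ * (γ ^ 4)⁻¹ * B⁻¹ ≤ 2 * κ * (γ ^ 4)⁻¹ * (55 * γ) := by gcongr
    have h5 : 0 ≤ κ' - κ - 2 * κ * (γ ^ 4)⁻¹ * B⁻¹ := by
      rw [hκ']
      linarith
    have h6 : 0 ≤ β * s ^ 2 * u s * exp ((u s) ^ 2)
          - B * (2 - 2 * κ * (γ ^ 4)⁻¹ - κ * B) := by linarith
    positivity

end Bubble

namespace Bubble

variable {lam β γ μ : ℝ} {u : ℝ → ℝ}

theorem forty_mul_log_div_le (D : Bubble lam β γ μ u) : 40 * log γ / γ ≤ 1 / 1000 := by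
  rw [div_le_iff₀ (by linarith [D.large])]
  linarith [D.log_le, D.one_le_log]

theorem le_expFlux_outer (D : Bubble lam β γ μ u) {r : ℝ} (h0 : μ * γ ≤ r) (h1 : r ≤ 1) :
    2 / γ - 240 / γ ^ 3 ≤ expFlux β u r := by
  have hγ : 0 < γ := by linarith [D.large]
  have h := D.inv_expFlux_le h0 h1
  have hp : 0 < expFlux β u r := D.expFlux_pos (D.scale_le_scale_mul.trans h0) h1
  rw [inv_le_comm₀ hp (by positivity)] at h
  refine le_trans ?_ h
  rw [← one_div, le_div_iff₀ (by positivity)]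
  have e : (2 / γ - 240 / γ ^ 3) * (γ / 2 + 60 / γ) = 1 - 14400 / γ ^ 4 := by
    field_simp
    ring
  rw [e]
  have : 0 ≤ 14400 / γ ^ 4 := by positivity
  linarith

theorem log_sub_log_le (D : Bubble lam β γ μ u) {r : ℝ} (h0 : μ * γ ≤ r) (h1 : r ≤ 1) :
    log r - log (μ * γ) ≤ (γ / 2 + 60 / γ) * (u (μ * γ) - u r) := by
  have hγ : 0 < γ := by linarith [D.large]
  have hR : 0 < μ * γ := mul_pos D.scale_pos hγ
  set B := expFlux β u (μ * γ) with hB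
  have hp : 0 < B := D.expFlux_pos D.scale_le_scale_mul (h0.trans h1)
  have hd := D.le_drop (K := B) hR h0 h1 (by
    intro s hs
    have hs' : s ∈ Icc (0:ℝ) 1 := ⟨hR.le.trans hs.1.le, hs.2.le.trans h1⟩
    exact (D.monotoneOn_expFlux ⟨hR.le, h0.trans h1⟩ hs' hs.1.le).trans (D.expFlux_le_flux hs'))
  have h2 : 0 ≤ u (μ * γ) - u r := by
    have := D.antitoneOn ⟨hR.le, h0.trans h1⟩ ⟨hR.le.trans h0, h1⟩ h0
    linarith
  calc log r - log (μ * γ) = B⁻¹ * (B * (log r - log (μ * γ))) := by field_simp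
    _ ≤ B⁻¹ * (u (μ * γ) - u r) := by gcongr
    _ ≤ _ := by
      gcongr
      exact D.inv_expFlux_le le_rfl (h0.trans h1)

theorem log_sub_log_le_sq (D : Bubble lam β γ μ u) {r : ℝ} (h0 : μ * γ ≤ r) (h1 : r ≤ 1) :
    log r - log (μ * γ) ≤ γ ^ 2 := by
  have hγ : 0 < γ := by linarith [D.large]
  have hR : 0 < μ * γ := mul_pos D.scale_pos hγ
  have h2 := D.le_center ⟨hR.le, h0.trans h1⟩
  have h3 := D.nonneg ⟨hR.le.trans h0, h1⟩
  have h4 : γ / 2 + 60 / γ ≤ γ := by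
    have : 60 / γ ≤ γ / 2 := by
      rw [div_le_iff₀ hγ]
      nlinarith [D.large]
    linarith
  calc _ ≤ _ := D.log_sub_log_le h0 h1
    _ ≤ (γ / 2 + 60 / γ) * γ := by
      gcongr
      linarith
    _ ≤ γ * γ := by gcongr
    _ = γ ^ 2 := by ring

theorem drop_outer (D : Bubble lam β γ μ u) {r : ℝ} (h0 : μ * γ ≤ r) (h1 : r ≤ 1) :
    (2 / γ - 240 / γ ^ 3) * (log r - log (μ * γ)) ≤ u (μ * γ) - u r := by
  have hγ : 0 < γ := by linarith [D.large]
  have hR : 0 < μ * γ := mul_pos D.scale_pos hγ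
  refine D.le_drop hR h0 h1 ?_
  intro s hs
  have hs' : s ∈ Icc (0:ℝ) 1 := ⟨hR.le.trans hs.1.le, hs.2.le.trans h1⟩
  exact (D.le_expFlux_outer hs.1.le hs'.2).trans (D.expFlux_le_flux hs')

theorem density_outer_le (D : Bubble lam β γ μ u) {r : ℝ} (h0 : μ * γ ^ 6 ≤ r) (h1 : r ≤ 1)
    (hu : 1 / 2 ≤ u r) : β * r ^ 2 * u r * exp ((u r) ^ 2) ≤ 5 / γ ^ 5 := by
  have hγ : 0 < γ := by linarith [D.large]
  have hR : 0 < μ * γ := mul_pos D.scale_pos hγ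
  have hR' : 0 < μ * γ ^ 6 := mul_pos D.scale_pos (by positivity)
  have hra : μ * γ ≤ r := D.scale_mul_le.trans h0
  have hr0 : 0 < r := hR'.trans_le h0
  have hL := D.one_le_log
  have hsmall := D.forty_mul_log_div_le
  have hua := D.sub_le D.scale_le_scale_mul D.scale_mul_le
  have huaγ := D.le_center ⟨hR.le, hra.trans h1⟩
  have hlog := D.log_sub_log_le hra h1
  have hbr : u r ≤ u (μ * γ ^ 6) := D.antitoneOn ⟨hR'.le, h0.trans h1⟩ ⟨hr0.le, h1⟩ h0
  have hab := D.drop_outer D.scale_mul_le D.scale_mul_pow_le_one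
  have hPa : β * (μ * γ) ^ 2 * u (μ * γ) * exp (u (μ * γ) ^ 2) ≤ 5 / γ := by
    have hm : μ * γ ∈ Icc (0:ℝ) 1 := ⟨hR.le, hra.trans h1⟩
    have h2 := D.density_le hm
    have h3 := D.mul_expFlux_le_two hm
    have h4 := D.expFlux_nonneg hm
    have h5 : 0.9 * γ ≤ u (μ * γ) := by linarith [D.large]
    have h6 : expFlux β u (μ * γ) ≤ 2.5 / γ := by
      rw [le_div_iff₀ hγ]
      nlinarith
    have : 0 ≤ u (μ * γ) := by linarith
    have h7 : 0 ≤ u (μ * γ) * expFlux β u (μ * γ) ^ 2 := by positivity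
    have h8 : 5 / γ = 2 * (2.5 / γ) := by ring
    rw [h8]
    nlinarith
  set a := u (μ * γ) with ha
  have hgap : 9 * log γ / γ ≤ a - u r := by
    have e : log (μ * γ ^ 6) - log (μ * γ) = 5 * log γ := by
      rw [log_mul D.scale_pos.ne' (by positivity), log_mul D.scale_pos.ne' hγ.ne', log_pow]
      push_cast
      ring
    rw [e] at hab
    have h2 : 1.8 / γ ≤ 2 / γ - 240 / γ ^ 3 := by
      have : 240 / γ ^ 3 = (240 / γ ^ 2) / γ := by field_simp
      rw [this, ← sub_div]
      gcongr
      have : 240 / γ ^ 2 ≤ 0.2 := by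
        rw [div_le_iff₀ (by positivity)]
        nlinarith [D.large]
      linarith
    calc 9 * log γ / γ = 1.8 / γ * (5 * log γ) := by ring
      _ ≤ (2 / γ - 240 / γ ^ 3) * (5 * log γ) := by gcongr
      _ ≤ _ := hab
      _ ≤ _ := by linarith
  have hexp : 4 * log γ ≤ (a - u r) * (u r / 2) := by
    have hpos : 0 ≤ 9 * log γ / γ := by positivity
    rcases le_total (0.9 * γ) (u r) with h | h
    · calc 4 * log γ ≤ 9 * log γ / γ * (0.9 * γ / 2) := by
            have : 9 * log γ / γ * (0.9 * γ / 2) = 4.05 * log γ := by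
              field_simp
              norm_num
            linarith
        _ ≤ _ := by gcongr; exact hpos.trans hgap
    · have : 0.05 * γ ≤ a - u r := by linarith [D.large]
      calc 4 * log γ ≤ (0.05 * γ) * ((1 / 2) / 2) := by linarith [D.log_le]
        _ ≤ _ := by gcongr; linarith [D.large]
  have hr2 : r ^ 2 = (μ * γ) ^ 2 * exp (2 * (log r - log (μ * γ))) := by
    rw [← log_div hr0.ne' hR.ne', two_mul, exp_add, exp_log (by positivity)]
    have := D.scale_pos.ne'
    field_simp
  have hE : 2 * (log r - log (μ * γ)) + u r ^ 2 ≤ a ^ 2 - 4 * log γ := by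
    have h60 : 120 / γ ≤ 1 / 1000 := by
      rw [div_le_iff₀ hγ]
      linarith [D.large]
    have e60 : 2 * (60 / γ) = 120 / γ := by ring
    have h3 : (a - u r) * (γ + 120 / γ) ≤ (a - u r) * (a + u r / 2) := by
      apply mul_le_mul_of_nonneg_left
      · linarith
      · exact (by positivity : (0:ℝ) ≤ 9 * log γ / γ).trans hgap
    nlinarith
  calc β * r ^ 2 * u r * exp ((u r) ^ 2)
      = β * (μ * γ) ^ 2 * u r * exp (2 * (log r - log (μ * γ)) + u r ^ 2) := by
        rw [exp_add, hr2]
        ring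
    _ ≤ β * (μ * γ) ^ 2 * a * exp (a ^ 2 - 4 * log γ) := by
        have := D.beta_pos
        have h5 : u r ≤ a := by
          have := (by positivity : (0:ℝ) ≤ 9 * log γ / γ).trans hgap
          linarith
        have : 0 ≤ a := by linarith
        gcongr
    _ = (β * (μ * γ) ^ 2 * a * exp (a ^ 2)) * (γ ^ 4)⁻¹ := by
        have : exp (4 * log γ) = γ ^ 4 := by
          have := exp_nat_mul (log γ) 4
          push_cast at this
          rw [this, exp_log hγ]
        rw [exp_sub, this]
        ring
    _ ≤ (5 / γ) * (γ ^ 4)⁻¹ := by gcongr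
    _ = 5 / γ ^ 5 := by field_simp

theorem expFlux_le_of_half_le (D : Bubble lam β γ μ u) {r : ℝ} (hr : r ∈ Icc (0:ℝ) 1)
    (hu : 1 / 2 ≤ u r) : expFlux β u r ≤ 2 / γ + 110 * log γ / γ ^ 3 := by
  have hγ : 0 < γ := by linarith [D.large]
  have hL := D.one_le_log
  set b := μ * γ ^ 6 with hb
  have hb0 : 0 < b := mul_pos D.scale_pos (by positivity)
  have hb1 : b ≤ 1 := D.scale_mul_pow_le_one
  have hBb : expFlux β u b ≤ 2 / γ + 100 * log γ / γ ^ 3 := by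
    have h2 := D.mul_expFlux_le_two ⟨hb0.le, hb1⟩
    have h3 := D.sub_le (D.scale_le_scale_mul.trans D.scale_mul_le) le_rfl
    have h4 := D.expFlux_nonneg ⟨hb0.le, hb1⟩
    have hs := D.forty_mul_log_div_le
    have h5 : 0 < γ - 40 * log γ / γ := by linarith [D.large]
    have h6 : expFlux β u b ≤ 2 / (γ - 40 * log γ / γ) := by
      rw [le_div_iff₀ h5]
      nlinarith
    refine h6.trans ?_
    rw [div_le_iff₀ h5]
    have e : (2 / γ + 100 * log γ / γ ^ 3) * (γ - 40 * log γ / γ)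
      = 2 + (log γ / γ ^ 2) * (20 - 100 * (40 * log γ / γ) / γ) := by
      field_simp
      ring
    rw [e]
    have h7 : 100 * (40 * log γ / γ) / γ ≤ 20 := by
      rw [div_le_iff₀ hγ]
      linarith [D.large]
    have := mul_nonneg (by positivity : 0 ≤ log γ / γ ^ 2) (sub_nonneg.2 h7)
    linarith
  have hinc : 100 * log γ / γ ^ 3 + 5 / γ ^ 3 ≤ 110 * log γ / γ ^ 3 := by
    rw [← add_div]
    gcongr
    linarith
  rcases le_total r b with h | h
  · have := D.monotoneOn_expFlux hr ⟨hb0.le, hb1⟩ h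
    have : 0 ≤ 5 / γ ^ 3 := by positivity
    linarith
  · have hcB := continuous_expFlux D.cont β
    have key := le_of_hasDerivAt_nonneg
      (f := fun s => 5 / γ ^ 5 * log s - expFlux β u s)
      (f' := fun s => 5 / γ ^ 5 * s⁻¹ - s * (β * u s * exp ((u s) ^ 2))) h ?_ ?_ ?_
    · have h2 := D.log_sub_log_le_sq (D.scale_mul_le.trans h) hr.2
      have h3 : log (μ * γ) ≤ log b := log_le_log (mul_pos D.scale_pos hγ) D.scale_mul_le
      have h4 : 5 / γ ^ 5 * (log r - log b) ≤ 5 / γ ^ 5 * γ ^ 2 := by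
        gcongr
        linarith
      have h5 : 5 / γ ^ 5 * γ ^ 2 = 5 / γ ^ 3 := by field_simp
      linarith
    · refine ContinuousOn.sub (continuousOn_const.mul (continuousOn_log.mono ?_)) (by fun_prop)
      intro x hx
      exact (hb0.trans_le hx.1).ne'
    · intro s hs
      exact ((hasDerivAt_log (hb0.trans hs.1).ne').const_mul _).sub (hasDerivAt_expFlux D.cont β s)
    · intro s hs
      have hs0 : 0 < s := hb0.trans hs.1
      have hs1 : s ≤ 1 := hs.2.le.trans hr.2
      have h2 := D.density_outer_le hs.1.le hs1
        (hu.trans (D.antitoneOn ⟨hs0.le, hs1⟩ hr hs.2.le))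
      have e : 5 / γ ^ 5 * s⁻¹ - s * (β * u s * exp ((u s) ^ 2))
        = (5 / γ ^ 5 - β * s ^ 2 * u s * exp ((u s) ^ 2)) / s := by
        field_simp
      rw [e]
      exact div_nonneg (by linarith) hs0.le

end Bubble

theorem intervalIntegral_mono_of_continuous {f g : ℝ → ℝ} {a b : ℝ} (hab : a ≤ b)
    (hf : Continuous f) (hg : Continuous g) (h : ∀ x ∈ Icc a b, f x ≤ g x) :
    ∫ x in a..b, f x ≤ ∫ x in a..b, g x :=
  intervalIntegral.integral_mono_on hab (hf.intervalIntegrable _ _) (hg.intervalIntegrable _ _) h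

/-- The pairing `∫₀¹ s u(s) v(s) ds`. -/
def pairing (u v : ℝ → ℝ) : ℝ := ∫ s in (0:ℝ)..1, s * u s * v s

/-- The pairing of the exponential nonlinearity with `v`. -/
def expPairing (β : ℝ) (u v : ℝ → ℝ) : ℝ :=
  ∫ s in (0:ℝ)..1, s * (β * u s * exp ((u s) ^ 2)) * v s

namespace RadialProfile

variable {lam β γ lam1 c : ℝ} {u v : ℝ → ℝ}

theorem mul_pairing_eq (P : RadialProfile lam β γ u) (Q : RadialProfile lam1 0 c v) :
    (lam1 - lam) * pairing u v = expPairing β u v := by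
  have hu := P.cont
  have hv := Q.cont
  have hFu := continuous_flux hu lam β
  have hFv := continuous_flux hv lam1 0
  have hI1 : Continuous (fun s => s * u s * v s) := by fun_prop
  have hI2 : Continuous (fun s => s * (β * u s * exp ((u s) ^ 2)) * v s) := by fun_prop
  set W : ℝ → ℝ := fun r => flux lam1 0 v r * u r - flux lam β u r * v r
    - ((lam1 - lam) * (∫ s in (0:ℝ)..r, s * u s * v s)
      - ∫ s in (0:ℝ)..r, s * (β * u s * exp ((u s) ^ 2)) * v s) with hW
  have hWd : ∀ r ∈ Ioo (0:ℝ) 1, HasDerivAt W 0 r := by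
    intro r hr
    have h := (((hasDerivAt_flux hv lam1 0 r).mul (P.hasDerivAt r hr)).sub
      ((hasDerivAt_flux hu lam β r).mul (Q.hasDerivAt r hr))).sub
      (((hI1.integral_hasStrictDerivAt 0 r).hasDerivAt.const_mul (lam1 - lam)).sub
        (hI2.integral_hasStrictDerivAt 0 r).hasDerivAt)
    refine h.congr_deriv ?_
    have := hr.1.ne'
    field_simp
    ring
  have hWc : Continuous W := by
    have h1 : Continuous (fun r => ∫ s in (0:ℝ)..r, s * u s * v s) :=
      intervalIntegral.continuous_primitive (fun a b => hI1.intervalIntegrable a b) 0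
    have h2 : Continuous (fun r => ∫ s in (0:ℝ)..r, s * (β * u s * exp ((u s) ^ 2)) * v s) :=
      intervalIntegral.continuous_primitive (fun a b => hI2.intervalIntegrable a b) 0
    fun_prop
  have h1 := le_of_hasDerivAt_nonneg zero_le_one hWc.continuousOn hWd (fun _ _ => le_rfl)
  have h2 := le_of_hasDerivAt_nonneg zero_le_one hWc.neg.continuousOn
    (fun r hr => (hWd r hr).neg) (fun _ _ => by simp)
  simp only [hW, flux_zero, intervalIntegral.integral_same, P.one, Q.one, Pi.neg_apply] at h1 h2
  unfold pairing expPairing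
  linarith

theorem expPairing_le (P : RadialProfile lam β γ u) (Q : RadialProfile lam1 0 c v) {r η : ℝ}
    (hr : r ∈ Icc (0:ℝ) 1) (hη : β * exp ((u r) ^ 2) ≤ η) :
    expPairing β u v ≤ c * expFlux β u r + η * pairing u v := by
  have hu := P.cont
  have hv := Q.cont
  have hI1 : Continuous (fun s => s * u s * v s) := by fun_prop
  have hI2 : Continuous (fun s => s * (β * u s * exp ((u s) ^ 2)) * v s) := by fun_prop
  have hI3 : Continuous (fun s => s * (β * u s * exp ((u s) ^ 2))) := by fun_prop
  have hβ := P.beta_nonneg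
  unfold expPairing pairing expFlux
  rw [← intervalIntegral.integral_add_adjacent_intervals (hI2.intervalIntegrable 0 r)
    (hI2.intervalIntegrable r 1), ← intervalIntegral.integral_add_adjacent_intervals
    (hI1.intervalIntegrable 0 r) (hI1.intervalIntegrable r 1)]
  have hη0 : 0 ≤ η := le_trans (by positivity) hη
  have h1 : ∫ s in (0:ℝ)..r, s * (β * u s * exp ((u s) ^ 2)) * v s
      ≤ c * ∫ s in (0:ℝ)..r, s * (β * u s * exp ((u s) ^ 2)) := by
    rw [← intervalIntegral.integral_const_mul]
    refine intervalIntegral_mono_of_continuous hr.1 hI2 (by fun_prop) ?_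
    intro s hs
    have hs' : s ∈ Icc (0:ℝ) 1 := ⟨hs.1, hs.2.trans hr.2⟩
    have h2 := P.nonneg hs'
    have h3 := Q.le_center hs'
    have h4 := hs.1
    rw [mul_comm c]
    gcongr
  have h2 : ∫ s in r..1, s * (β * u s * exp ((u s) ^ 2)) * v s
      ≤ η * ∫ s in r..1, s * u s * v s := by
    rw [← intervalIntegral.integral_const_mul]
    refine intervalIntegral_mono_of_continuous hr.2 hI2 (by fun_prop) ?_
    intro s hs
    have hs' : s ∈ Icc (0:ℝ) 1 := ⟨hr.1.trans hs.1, hs.2⟩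
    have h2 := P.nonneg hs'
    have h3 := Q.nonneg hs'
    have h4 := hs'.1
    have h5 : β * exp ((u s) ^ 2) ≤ η := by
      refine le_trans ?_ hη
      have := P.antitoneOn hr hs' hs.1
      gcongr
    have e : s * (β * u s * exp ((u s) ^ 2)) * v s = (β * exp ((u s) ^ 2)) * (s * u s * v s) := by
      ring
    rw [e]
    gcongr
  have h3 : 0 ≤ ∫ s in (0:ℝ)..r, s * u s * v s := by
    apply intervalIntegral.integral_nonneg hr.1
    intro s hs
    have hs' : s ∈ Icc (0:ℝ) 1 := ⟨hs.1, hs.2.trans hr.2⟩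
    have := P.nonneg hs'
    have := Q.nonneg hs'
    have := hs.1
    positivity
  nlinarith

theorem mul_pairing_le (P : RadialProfile lam β γ u) (Q : RadialProfile lam1 0 c v) {r η : ℝ}
    (hr : r ∈ Icc (0:ℝ) 1) (hη0 : 0 ≤ η) (hη : η ≤ β * exp ((u r) ^ 2)) :
    η * pairing u v ≤ c * expFlux β u r + η * (u r * c) := by
  have hu := P.cont
  have hv := Q.cont
  have hI1 : Continuous (fun s => s * u s * v s) := by fun_prop
  have hI3 : Continuous (fun s => s * (β * u s * exp ((u s) ^ 2))) := by fun_prop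
  have hβ := P.beta_nonneg
  unfold pairing expFlux
  rw [← intervalIntegral.integral_add_adjacent_intervals
    (hI1.intervalIntegrable 0 r) (hI1.intervalIntegrable r 1)]
  have h1 : η * ∫ s in (0:ℝ)..r, s * u s * v s
      ≤ c * ∫ s in (0:ℝ)..r, s * (β * u s * exp ((u s) ^ 2)) := by
    rw [← intervalIntegral.integral_const_mul, ← intervalIntegral.integral_const_mul]
    refine intervalIntegral_mono_of_continuous hr.1 (by fun_prop) (by fun_prop) ?_
    intro s hs
    have hs' : s ∈ Icc (0:ℝ) 1 := ⟨hs.1, hs.2.trans hr.2⟩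
    have h2 := P.nonneg hs'
    have h3 := Q.le_center hs'
    have h6 := Q.nonneg hs'
    have h7 := P.nonneg hr
    have h4 := hs.1
    have h5 : η ≤ β * exp ((u s) ^ 2) := by
      refine hη.trans ?_
      have := P.antitoneOn hs' hr hs.2
      gcongr
    calc η * (s * u s * v s) ≤ (β * exp ((u s) ^ 2)) * (s * u s * c) := by gcongr
      _ = _ := by ring
  have h2 : ∫ s in r..1, s * u s * v s ≤ u r * c := by
    have hc := Q.center_pos
    have hur := P.nonneg hr
    calc ∫ s in r..1, s * u s * v s ≤ ∫ _ in r..1, u r * c := by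
          refine intervalIntegral_mono_of_continuous hr.2 (by fun_prop) (by fun_prop) ?_
          intro s hs
          have hs' : s ∈ Icc (0:ℝ) 1 := ⟨hr.1.trans hs.1, hs.2⟩
          have h2 := P.nonneg hs'
          have h3 := Q.nonneg hs'
          have h4 := P.antitoneOn hr hs' hs.1
          have h5 := Q.le_center hs'
          calc s * u s * v s ≤ 1 * u r * c := by
                gcongr
                exact hs.2
            _ = u r * c := by ring
      _ = (1 - r) * (u r * c) := by
          simp
          ring
      _ ≤ 1 * (u r * c) := by
          gcongr
          linarith [hr.1]
      _ = _ := one_mul _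
  have := mul_le_mul_of_nonneg_left h2 hη0
  linarith

theorem le_expPairing (P : RadialProfile lam β γ u) (Q : RadialProfile lam1 0 c v) {r : ℝ}
    (hr : r ∈ Icc (0:ℝ) 1) : v r * expFlux β u r ≤ expPairing β u v := by
  have hu := P.cont
  have hv := Q.cont
  have hI2 : Continuous (fun s => s * (β * u s * exp ((u s) ^ 2)) * v s) := by fun_prop
  have hβ := P.beta_nonneg
  have hnn : ∀ s ∈ Icc (0:ℝ) 1, 0 ≤ s * (β * u s * exp ((u s) ^ 2)) := by
    intro s hs
    have := P.nonneg hs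
    have := hs.1
    positivity
  unfold expPairing expFlux
  rw [← intervalIntegral.integral_add_adjacent_intervals (hI2.intervalIntegrable 0 r)
    (hI2.intervalIntegrable r 1), ← intervalIntegral.integral_const_mul]
  have h1 : ∫ s in (0:ℝ)..r, v r * (s * (β * u s * exp ((u s) ^ 2)))
      ≤ ∫ s in (0:ℝ)..r, s * (β * u s * exp ((u s) ^ 2)) * v s := by
    refine intervalIntegral_mono_of_continuous hr.1 (by fun_prop) hI2 ?_
    intro s hs
    have hs' : s ∈ Icc (0:ℝ) 1 := ⟨hs.1, hs.2.trans hr.2⟩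
    rw [mul_comm]
    exact mul_le_mul_of_nonneg_left (Q.antitoneOn hs' hr hs.2) (hnn s hs')
  have h2 : 0 ≤ ∫ s in r..1, s * (β * u s * exp ((u s) ^ 2)) * v s := by
    apply intervalIntegral.integral_nonneg hr.2
    intro s hs
    have hs' : s ∈ Icc (0:ℝ) 1 := ⟨hr.1.trans hs.1, hs.2⟩
    exact mul_nonneg (hnn s hs') (Q.nonneg hs')
  linarith

theorem mul_linFlux_le (P : RadialProfile lam β γ u) (Q : RadialProfile lam1 0 c v) :
    v (1 / 2) * linFlux u 1 ≤ 4 * pairing u v := by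
  have hu := P.cont
  have hv := Q.cont
  have hh : (1 / 2 : ℝ) ∈ Icc (0:ℝ) 1 := by norm_num
  have hI1 : Continuous (fun s => s * u s * v s) := by fun_prop
  have hI : Continuous (fun s => s * u s) := by fun_prop
  have h1 : v (1 / 2) * linFlux u (1 / 2) ≤ pairing u v := by
    unfold pairing linFlux
    rw [← intervalIntegral.integral_add_adjacent_intervals (hI1.intervalIntegrable 0 (1 / 2))
      (hI1.intervalIntegrable (1 / 2) 1), ← intervalIntegral.integral_const_mul]
    have h1 : ∫ s in (0:ℝ)..(1 / 2), v (1 / 2) * (s * u s)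
        ≤ ∫ s in (0:ℝ)..(1 / 2), s * u s * v s := by
      refine intervalIntegral_mono_of_continuous hh.1 (by fun_prop) hI1 ?_
      intro s hs
      have hs' : s ∈ Icc (0:ℝ) 1 := ⟨hs.1, hs.2.trans hh.2⟩
      rw [mul_comm]
      exact mul_le_mul_of_nonneg_left (Q.antitoneOn hs' hh hs.2) (mul_nonneg hs.1 (P.nonneg hs'))
    have h2 : 0 ≤ ∫ s in (1 / 2 : ℝ)..1, s * u s * v s := by
      apply intervalIntegral.integral_nonneg hh.2
      intro s hs
      have hs' : s ∈ Icc (0:ℝ) 1 := ⟨hh.1.trans hs.1, hs.2⟩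
      exact mul_nonneg (mul_nonneg hs'.1 (P.nonneg hs')) (Q.nonneg hs')
    linarith
  have h2 : u (1 / 2) / 8 ≤ linFlux u (1 / 2) := by
    have e : ∫ s in (0:ℝ)..(1 / 2), s * u (1 / 2) = u (1 / 2) / 8 := by
      rw [intervalIntegral.integral_mul_const, integral_id]
      ring
    rw [← e]
    refine intervalIntegral_mono_of_continuous hh.1 (by fun_prop) hI ?_
    intro s hs
    have hs' : s ∈ Icc (0:ℝ) 1 := ⟨hs.1, hs.2.trans hh.2⟩
    exact mul_le_mul_of_nonneg_left (P.antitoneOn hs' hh hs.2) hs.1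
  have h3 : linFlux u 1 - linFlux u (1 / 2) ≤ 3 * (u (1 / 2) / 8) := by
    have e : ∫ s in (1 / 2 : ℝ)..1, s * u (1 / 2) = 3 * (u (1 / 2) / 8) := by
      rw [intervalIntegral.integral_mul_const, integral_id]
      ring
    rw [← e]
    unfold linFlux
    rw [intervalIntegral.integral_interval_sub_left (hI.intervalIntegrable _ _)
      (hI.intervalIntegrable _ _)]
    refine intervalIntegral_mono_of_continuous hh.2 hI (by fun_prop) ?_
    intro s hs
    have hs' : s ∈ Icc (0:ℝ) 1 := ⟨hh.1.trans hs.1, hs.2⟩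
    exact mul_le_mul_of_nonneg_left (P.antitoneOn hh hs' hs.1) hs'.1
  have h4 := Q.nonneg hh
  nlinarith

theorem pairing_le (P : RadialProfile lam β γ u) (Q : RadialProfile lam1 0 c v) :
    pairing u v ≤ c * linFlux u 1 := by
  have hu := P.cont
  have hv := Q.cont
  unfold pairing linFlux
  rw [← intervalIntegral.integral_const_mul]
  refine intervalIntegral_mono_of_continuous zero_le_one (by fun_prop) (by fun_prop) ?_
  intro s hs
  rw [mul_comm c]
  exact mul_le_mul_of_nonneg_left (Q.le_center hs) (mul_nonneg hs.1 (P.nonneg hs))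

theorem two_mul_linFlux_sq_le (P : RadialProfile lam β γ u) :
    2 * linFlux u 1 ^ 2 ≤ ∫ s in (0:ℝ)..1, s * u s ^ 2 := by
  have hu := P.cont
  set L := linFlux u 1 with hL
  have h : 0 ≤ ∫ s in (0:ℝ)..1, s * (u s - 2 * L) ^ 2 := by
    apply intervalIntegral.integral_nonneg zero_le_one
    intro s hs
    exact mul_nonneg hs.1 (sq_nonneg _)
  have e : ∀ s, s * (u s - 2 * L) ^ 2 = s * u s ^ 2 - 4 * L * (s * u s) + 4 * L ^ 2 * s := by
    intro s
    ring
  simp_rw [e] at h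
  rw [intervalIntegral.integral_add, intervalIntegral.integral_sub,
    intervalIntegral.integral_const_mul, intervalIntegral.integral_const_mul, integral_id] at h
  · have : ∫ s in (0:ℝ)..1, s * u s = L := rfl
    rw [this] at h
    linarith
  all_goals exact Continuous.intervalIntegrable (by fun_prop) _ _

end RadialProfile

theorem RadialProfile.expFlux_le_add_linFlux {lam β γ : ℝ} {u : ℝ → ℝ}
    (P : RadialProfile lam β γ u) {r s η : ℝ} (hr : 0 ≤ r) (hrs : r ≤ s) (hs : s ≤ 1)
    (hη : β * exp ((u r) ^ 2) ≤ η) :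
    expFlux β u s ≤ expFlux β u r + η * (linFlux u s - linFlux u r) := by
  have hcB := continuous_expFlux P.cont β
  have hcL := continuous_linFlux P.cont
  have key := le_of_hasDerivAt_nonneg (f := fun t => η * linFlux u t - expFlux β u t)
    (f' := fun t => η * (t * u t) - t * (β * u t * exp ((u t) ^ 2))) hrs (by fun_prop)
    (fun x _ => ((hasDerivAt_linFlux P.cont x).const_mul η).sub (hasDerivAt_expFlux P.cont β x))
    (by
      intro x hx
      have hx' : x ∈ Icc (0:ℝ) 1 := ⟨hr.trans hx.1.le, hx.2.le.trans hs⟩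
      have h1 := P.antitoneOn ⟨hr, hrs.trans hs⟩ hx' hx.1.le
      have h2 := P.nonneg hx'
      have h3 := P.beta_nonneg
      have h4 : β * exp ((u x) ^ 2) ≤ η := le_trans (by gcongr) hη
      have h5 : 0 ≤ x * u x := mul_nonneg hx'.1 h2
      have := mul_le_mul_of_nonneg_right h4 h5
      linarith)
  linarith

theorem scale_mul_pow_le_one_of_exp_le {β γ μ : ℝ} (hμ : 0 < μ) (hγ : 10 ^ 6 ≤ γ)
    (hlog : 10 ^ 6 * log γ ≤ γ) (hs : β * γ ^ 2 * exp (γ ^ 2) * μ ^ 2 = 4)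
    (hβ : exp (-(γ ^ 2 / 10)) ≤ β) : μ * γ ^ 50 ≤ 1 := by
  have hγ0 : 0 < γ := by linarith
  have h1 : γ ^ 100 ≤ β * exp (γ ^ 2) := by
    calc γ ^ 100 = exp (100 * log γ) := by
          rw [mul_comm, exp_mul, exp_log hγ0]
          norm_cast
      _ ≤ exp (-(γ ^ 2 / 10) + γ ^ 2) := by
          apply exp_le_exp.2
          nlinarith
      _ = exp (-(γ ^ 2 / 10)) * exp (γ ^ 2) := exp_add _ _
      _ ≤ _ := by gcongr
  have h2 : (μ * γ ^ 50) ^ 2 * γ ^ 2 ≤ 4 := by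
    calc (μ * γ ^ 50) ^ 2 * γ ^ 2 = γ ^ 100 * (γ ^ 2 * μ ^ 2) := by ring
      _ ≤ (β * exp (γ ^ 2)) * (γ ^ 2 * μ ^ 2) := by gcongr
      _ = 4 := by rw [← hs]; ring
  have h3 : 0 ≤ μ * γ ^ 50 := by positivity
  have h4 : (2:ℝ) ^ 2 ≤ γ ^ 2 := by
    gcongr
    linarith
  by_contra! h
  have h5 : 1 < (μ * γ ^ 50) ^ 2 := one_lt_pow₀ h two_ne_zero
  nlinarith

theorem RadialProfile.scale_mul_pow_le_one_of_le {lam β γ lam1 c μ κ : ℝ} {u v : ℝ → ℝ}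
    (P : RadialProfile lam β γ u) (Q : RadialProfile lam1 0 c v) (hκ : 0 < κ)
    (hgap : lam1 - lam = κ / γ) (hγ : 10 ^ 6 ≤ γ)
    (hs : β * γ ^ 2 * exp (γ ^ 2) * μ ^ 2 = 4) (hlam : lam ≤ γ)
    (hβ : β * exp ((γ / 5) ^ 2) ≤ κ / γ / 2)
    (hlog : 250 * (1 + lam1 * (80 * c / (κ * v (1 / 2)))) * log γ ≤ γ) : μ * γ ^ 50 ≤ 1 := by
  have hγ0 : 0 < γ := by linarith
  have hc := Q.center_pos
  have hm : 0 < v (1 / 2) := Q.pos _ (by norm_num)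
  have hlam1 := Q.lam_nonneg
  obtain ⟨r, hr, hur⟩ := P.exists_eq (c := γ / 5) (by positivity) (by linarith)
  have hr0 : 0 < r := by
    rcases hr.1.lt_or_eq with h | h
    · exact h
    · rw [← h, P.zero] at hur
      linarith
  have hB : expFlux β u r ≤ 10 / γ := by
    have := P.mul_expFlux_le_two hr
    rw [hur] at this
    rw [le_div_iff₀ hγ0]
    linarith
  rw [← hur] at hβ
  have hN := P.expPairing_le Q hr hβ
  rw [← P.mul_pairing_eq Q, hgap] at hN
  have hN' : κ * pairing u v ≤ 20 * c := by
    have h1 : κ / γ / 2 * pairing u v ≤ c * (10 / γ) := by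
      have := mul_le_mul_of_nonneg_left hB hc.le
      linarith
    have e1 : κ / γ / 2 * pairing u v = (κ * pairing u v) / (2 * γ) := by field_simp
    have e2 : c * (10 / γ) = (20 * c) / (2 * γ) := by
      field_simp
      ring
    rw [e1, e2] at h1
    exact (div_le_div_iff_of_pos_right (by positivity)).1 h1
  set M := 80 * c / (κ * v (1 / 2)) with hM
  have hL1 : linFlux u 1 ≤ M := by
    rw [hM, le_div_iff₀ (by positivity)]
    have := P.mul_linFlux_le Q
    nlinarith
  have hM0 : 0 ≤ M := by positivity
  set K := 1 + lam1 * M with hK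
  have hK1 : 1 ≤ K := by
    have := mul_nonneg hlam1 hM0
    linarith
  have hd := P.drop_le (K := K) (k := 0) hr0 hr.2 le_rfl (by
    intro s hs
    have hs' : s ∈ Icc (0:ℝ) 1 := ⟨hr0.le.trans hs.1.le, hs.2.le⟩
    have h1 := P.expFlux_le_add_linFlux hr.1 hs.1.le hs'.2 hβ
    have h2 := P.linFlux_nonneg hr
    have h3 := P.linFlux_nonneg hs'
    have h4 : linFlux u s ≤ M := (P.monotoneOn_linFlux hs' (by simp) hs'.2).trans hL1
    have h5 : 10 / γ ≤ 1 := by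
      rw [div_le_one hγ0]
      linarith
    have h6 : 0 ≤ κ / γ / 2 := by positivity
    have h7 : 0 ≤ κ / γ := by positivity
    unfold flux
    have h8 : (κ / γ / 2 + lam) * linFlux u s ≤ lam1 * M := by
      apply mul_le_mul _ h4 h3 hlam1
      linarith
    nlinarith [mul_nonneg h6 h2])
  rw [hur, P.one, log_one] at hd
  have hlr : log r ≤ -(50 * log γ) := by
    have hK0 : 0 < K := by linarith
    have : K * (50 * log γ) ≤ K * (-log r) := by linarith
    have := le_of_mul_le_mul_left this hK0
    linarith
  have hlog0 : 0 ≤ log γ := log_nonneg (by linarith)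
  have hrγ : r * γ ^ 50 ≤ 1 := by
    rw [← log_nonpos_iff (by positivity), log_mul hr0.ne' (by positivity), log_pow]
    push_cast
    linarith
  refine le_trans ?_ hrγ
  gcongr
  by_contra! hlt
  have h1 := P.drop_center_le_sq hlam hr
  rw [hur] at h1
  have h2 : β * γ * exp (γ ^ 2) * r ^ 2 ≤ 4 / γ := by
    have hβ0 := P.beta_nonneg
    calc β * γ * exp (γ ^ 2) * r ^ 2 ≤ β * γ * exp (γ ^ 2) * μ ^ 2 := by gcongr
      _ = 4 / γ := by
          rw [eq_div_iff hγ0.ne', ← hs]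
          ring
  have h3 : γ * r ≤ 1 := by
    refine le_trans ?_ hrγ
    rw [mul_comm]
    gcongr
    exact le_self_pow₀ (by linarith) (by norm_num)
  have h4 : 4 / γ ≤ 1 := by
    rw [div_le_one hγ0]
    linarith
  have h5 : 0 ≤ γ * r := by positivity
  nlinarith

/-- Rapid smallness of the concentration scale. -/
theorem RadialProfile.scale_mul_pow_le_one {lam β γ lam1 c μ κ : ℝ} {u v : ℝ → ℝ}
    (P : RadialProfile lam β γ u) (Q : RadialProfile lam1 0 c v) (hκ : 0 < κ)
    (hgap : lam1 - lam = κ / γ) (hμ : 0 < μ) (hγ : 10 ^ 6 ≤ γ) (hlogγ : 10 ^ 6 * log γ ≤ γ)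
    (hs : β * γ ^ 2 * exp (γ ^ 2) * μ ^ 2 = 4) (hlam : lam ≤ γ)
    (hexp : exp (-γ) ≤ κ / γ / 2)
    (hlog : 250 * (1 + lam1 * (80 * c / (κ * v (1 / 2)))) * log γ ≤ γ) : μ * γ ^ 50 ≤ 1 := by
  rcases le_total (exp (-(γ ^ 2 / 10))) β with h | h
  · exact scale_mul_pow_le_one_of_exp_le hμ hγ hlogγ hs h
  · refine P.scale_mul_pow_le_one_of_le Q hκ hgap hγ hs hlam (le_trans ?_ hexp) hlog
    calc β * exp ((γ / 5) ^ 2) ≤ exp (-(γ ^ 2 / 10)) * exp ((γ / 5) ^ 2) := by gcongr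
      _ = exp (-(γ ^ 2 / 10) + (γ / 5) ^ 2) := (exp_add _ _).symm
      _ ≤ exp (-γ) := by
          apply exp_le_exp.2
          nlinarith

theorem neg_mul_log_le_one {s : ℝ} (hs : 0 < s) : s * (-log s) ≤ 1 := by
  have h := log_le_sub_one_of_pos (inv_pos.2 hs)
  rw [log_inv] at h
  calc s * (-log s) ≤ s * (s⁻¹ - 1) := by gcongr
    _ = 1 - s := by field_simp
    _ ≤ 1 := by linarith

theorem mul_log_sq_le_four {s : ℝ} (hs : 0 < s) (hs1 : s ≤ 1) : s * log s ^ 2 ≤ 4 := by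
  have h := neg_mul_log_le_one (sqrt_pos.2 hs)
  rw [log_sqrt hs.le] at h
  have h0 : 0 ≤ √s * (-(log s / 2)) := by
    have := log_nonpos hs.le hs1
    exact mul_nonneg (sqrt_nonneg s) (by linarith)
  have h2 := mul_le_one₀ h h0 h
  have e : √s * (-(log s / 2)) * (√s * (-(log s / 2))) = (√s * √s) * log s ^ 2 / 4 := by ring
  rw [e, mul_self_sqrt hs.le] at h2
  linarith

/-- A bubble whose linear coefficient lies `κ / γ` below the first eigenvalue. -/
structure NearEigen (lam β γ μ lam1 c κ : ℝ) (u v : ℝ → ℝ) : Prop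
    extends Bubble lam β γ μ u where
  eigen : RadialProfile lam1 0 c v
  gap_pos : 0 < κ
  gap_eq : lam1 - lam = κ / γ

/-- A bound for `linFlux u 1`. -/
def massBound (c κ m : ℝ) : ℝ := 4 * (6 * c / κ + c) / m

/-- A bound for `flux` away from the concentration point. -/
def slopeBound (lam1 c κ m : ℝ) : ℝ := 1 + lam1 * massBound c κ m

namespace NearEigen

variable {lam β γ μ lam1 c κ : ℝ} {u v : ℝ → ℝ}

theorem half_pos (D : NearEigen lam β γ μ lam1 c κ u v) : 0 < v (1 / 2) :=
  D.eigen.pos _ (by norm_num)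

theorem massBound_nonneg (D : NearEigen lam β γ μ lam1 c κ u v) :
    0 ≤ massBound c κ (v (1 / 2)) := by
  have := D.half_pos
  have := D.eigen.center_pos
  have := D.gap_pos
  unfold massBound
  positivity

theorem one_le_slopeBound (D : NearEigen lam β γ μ lam1 c κ u v) :
    1 ≤ slopeBound lam1 c κ (v (1 / 2)) := by
  have := mul_nonneg D.eigen.lam_nonneg D.massBound_nonneg
  unfold slopeBound
  linarith

theorem lam_le_eigen (D : NearEigen lam β γ μ lam1 c κ u v) : lam ≤ lam1 := by
  have h1 := D.gap_eq
  have h2 := D.gap_pos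
  have h3 := D.center_pos
  have : 0 ≤ κ / γ := by positivity
  linarith

theorem exists_eq_one (D : NearEigen lam β γ μ lam1 c κ u v) :
    ∃ r ∈ Ioc (0:ℝ) 1, u r = 1 ∧ expFlux β u r ≤ 3 / γ := by
  have hγ := D.center_pos
  have hl := D.large
  obtain ⟨r, hr, hur⟩ := D.exists_eq (c := 1) zero_le_one (by linarith)
  refine ⟨r, ⟨?_, hr.2⟩, hur, ?_⟩
  · rcases hr.1.lt_or_eq with h | h
    · exact h
    · rw [← h, D.zero] at hur
      linarith
  · refine (D.expFlux_le_of_half_le hr (by linarith)).trans ?_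
    have h1 : 110 * log γ / γ ^ 3 ≤ 1 / γ := by
      rw [div_le_div_iff₀ (by positivity) hγ]
      have := D.log_le
      have h2 : 110 * log γ ≤ γ ^ 2 := by nlinarith [D.one_le_log]
      nlinarith
    have e : 2 / γ + 1 / γ = 3 / γ := by ring
    linarith

theorem pairing_le_of_gap (D : NearEigen lam β γ μ lam1 c κ u v) :
    pairing u v ≤ 6 * c / κ + c := by
  have hγ := D.center_pos
  have hκ := D.gap_pos
  have hc := D.eigen.center_pos
  obtain ⟨r, hr, hur, hB⟩ := D.exists_eq_one
  have hr' : r ∈ Icc (0:ℝ) 1 := ⟨hr.1.le, hr.2⟩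
  have hcB := mul_le_mul_of_nonneg_left hB hc.le
  have hmain : κ / γ / 2 * pairing u v ≤ c * (3 / γ) + κ / γ / 2 * c := by
    rcases le_total (β * exp ((u r) ^ 2)) (κ / γ / 2) with h | h
    · have h1 := D.expPairing_le D.eigen hr' h
      rw [← D.mul_pairing_eq D.eigen, D.gap_eq] at h1
      have : 0 ≤ κ / γ / 2 * c := by positivity
      linarith
    · have h1 := D.mul_pairing_le D.eigen hr' (by positivity) h
      rw [hur, one_mul] at h1
      linarith
  have e : c * (3 / γ) + κ / γ / 2 * c = κ / γ / 2 * (6 * c / κ + c) := by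
    field_simp
    ring
  rw [e] at hmain
  exact le_of_mul_le_mul_left hmain (by positivity)

theorem linFlux_one_le (D : NearEigen lam β γ μ lam1 c κ u v) :
    linFlux u 1 ≤ massBound c κ (v (1 / 2)) := by
  have h1 := D.mul_linFlux_le D.eigen
  have h2 := D.pairing_le_of_gap
  unfold massBound
  rw [le_div_iff₀ D.half_pos]
  linarith

theorem le_expPairing_half (D : NearEigen lam β γ μ lam1 c κ u v) :
    v (1 / 2) / γ ≤ expPairing β u v := by
  have hγ := D.center_pos
  have hl := D.large
  have hh : (1 / 2 : ℝ) ∈ Icc (0:ℝ) 1 := by norm_num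
  refine le_trans ?_ (D.le_expPairing D.eigen hh)
  have hμ : μ * γ ≤ 1 / 2 := by
    refine (D.scale_mul_le.trans D.scale_mul_pow_le).trans ?_
    rw [inv_le_comm₀ (by positivity) (by norm_num)]
    have : γ ≤ γ ^ 14 := le_self_pow₀ (by linarith) (by norm_num)
    norm_num
    linarith
  have h := D.le_expFlux_outer hμ hh.2
  have h2 : 240 / γ ^ 3 ≤ 1 / γ := by
    rw [div_le_div_iff₀ (by positivity) hγ]
    have : (240:ℝ) ≤ γ ^ 2 := by nlinarith
    nlinarith
  have e : 2 / γ - 1 / γ = 1 / γ := by ring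
  rw [div_eq_mul_one_div]
  have := D.half_pos
  gcongr
  linarith

theorem pairing_pos (D : NearEigen lam β γ μ lam1 c κ u v) :
    v (1 / 2) / κ ≤ pairing u v := by
  have h := D.le_expPairing_half
  have hγ := D.center_pos
  have hκ := D.gap_pos
  rw [← D.mul_pairing_eq D.eigen, D.gap_eq, div_mul_eq_mul_div] at h
  rw [div_le_iff₀ hκ]
  have := (div_le_div_iff_of_pos_right hγ).1 h
  linarith

theorem le_integral_sq (D : NearEigen lam β γ μ lam1 c κ u v) :
    2 * (v (1 / 2) / (κ * c)) ^ 2 ≤ ∫ s in (0:ℝ)..1, s * u s ^ 2 := by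
  refine le_trans ?_ D.two_mul_linFlux_sq_le
  have hκ := D.gap_pos
  have hc := D.eigen.center_pos
  have hm := D.half_pos
  have h1 : v (1 / 2) / (κ * c) ≤ linFlux u 1 := by
    have h1 := D.pairing_pos.trans (D.pairing_le D.eigen)
    rw [← div_div, div_le_iff₀ hc]
    linarith
  gcongr

theorem beta_le (D : NearEigen lam β γ μ lam1 c κ u v) : β ≤ κ / γ := by
  have hu := D.cont
  have hv := D.eigen.cont
  have h : β * pairing u v ≤ κ / γ * pairing u v := by
    rw [← D.gap_eq, D.mul_pairing_eq D.eigen]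
    unfold pairing expPairing
    rw [← intervalIntegral.integral_const_mul]
    refine intervalIntegral_mono_of_continuous zero_le_one (by fun_prop) (by fun_prop) ?_
    intro s hs
    have h1 : 1 ≤ exp ((u s) ^ 2) := one_le_exp (sq_nonneg _)
    have h2 : 0 ≤ β * (s * u s * v s) :=
      mul_nonneg D.beta_nonneg (mul_nonneg (mul_nonneg hs.1 (D.nonneg hs)) (D.eigen.nonneg hs))
    calc β * (s * u s * v s) ≤ β * (s * u s * v s) * exp ((u s) ^ 2) :=
          le_mul_of_one_le_right h2 h1
      _ = _ := by ring
  refine le_of_mul_le_mul_right h ?_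
  exact lt_of_lt_of_le (div_pos D.half_pos D.gap_pos) D.pairing_pos

theorem le_one_add_slopeBound_mul (D : NearEigen lam β γ μ lam1 c κ u v) {r : ℝ}
    (hr : r ∈ Ioc (0:ℝ) 1) : u r ≤ 1 + slopeBound lam1 c κ (v (1 / 2)) * (-log r) := by
  obtain ⟨r₁, hr₁, hur, hB⟩ := D.exists_eq_one
  have hγ := D.center_pos
  have hK := D.one_le_slopeBound
  have hlr := log_nonpos hr.1.le hr.2
  rcases le_total r₁ r with h | h
  · have := D.antitoneOn ⟨hr₁.1.le, hr₁.2⟩ ⟨hr.1.le, hr.2⟩ h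
    nlinarith
  · have hd := D.drop_le (K := slopeBound lam1 c κ (v (1 / 2))) (k := 0) hr.1 h hr₁.2 (by
      intro s hs
      have hs' : s ∈ Icc (0:ℝ) 1 := ⟨hr.1.le.trans hs.1.le, hs.2.le.trans hr₁.2⟩
      have h1 := D.monotoneOn_expFlux hs' ⟨hr₁.1.le, hr₁.2⟩ hs.2.le
      have h2 := (D.monotoneOn_linFlux hs' (by simp) hs'.2).trans D.linFlux_one_le
      have h3 : lam * linFlux u s ≤ lam1 * massBound c κ (v (1 / 2)) :=
        mul_le_mul D.lam_le_eigen h2 (D.linFlux_nonneg hs') D.eigen.lam_nonneg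
      have h5 : 3 / γ ≤ 1 := by
        rw [div_le_one hγ]
        linarith [D.large]
      unfold flux slopeBound
      linarith)
    have hlr₁ := log_nonpos hr₁.1.le hr₁.2
    rw [hur] at hd
    nlinarith

theorem linFlux_le_mul (D : NearEigen lam β γ μ lam1 c κ u v) {r : ℝ}
    (hr : r ∈ Icc (0:ℝ) 1) : linFlux u r ≤ (1 + slopeBound lam1 c κ (v (1 / 2))) * r := by
  set K := slopeBound lam1 c κ (v (1 / 2)) with hK
  have hK1 : 1 ≤ K := D.one_le_slopeBound
  have hcL := continuous_linFlux D.cont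
  have key := le_of_hasDerivAt_nonneg (f := fun t => (1 + K) * t - linFlux u t)
    (f' := fun t => (1 + K) * 1 - t * u t) hr.1 (by fun_prop)
    (fun x _ => ((hasDerivAt_id x).const_mul _).sub (hasDerivAt_linFlux D.cont x)) (by
      intro x hx
      have h1 := D.le_one_add_slopeBound_mul ⟨hx.1, hx.2.le.trans hr.2⟩
      have h2 := neg_mul_log_le_one hx.1
      have h3 := mul_le_mul_of_nonneg_left h1 hx.1.le
      have h4 := mul_le_mul_of_nonneg_left h2 (zero_le_one.trans hK1)
      have := hx.2.trans_le hr.2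
      rw [← hK] at h3
      linarith)
  simp at key
  linarith

theorem le_add_mul_log (D : NearEigen lam β γ μ lam1 c κ u v) {r : ℝ}
    (hr : r ∈ Ioc (0:ℝ) 1) :
    u r ≤ 1 + lam1 * (1 + slopeBound lam1 c κ (v (1 / 2)))
      + (2 / γ + 110 * log γ / γ ^ 3) * (-log r) := by
  obtain ⟨r₁, hr₁, hur, hB⟩ := D.exists_eq_one
  have hr₁' : r₁ ∈ Icc (0:ℝ) 1 := ⟨hr₁.1.le, hr₁.2⟩
  have hγ := D.center_pos
  have hK := D.one_le_slopeBound
  have hL := D.one_le_log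
  have hlr := log_nonpos hr.1.le hr.2
  have hk : 0 ≤ lam1 * (1 + slopeBound lam1 c κ (v (1 / 2))) :=
    mul_nonneg D.eigen.lam_nonneg (by linarith)
  have hK2 : 0 ≤ 2 / γ + 110 * log γ / γ ^ 3 := by positivity
  rcases le_total r₁ r with h | h
  · have := D.antitoneOn hr₁' ⟨hr.1.le, hr.2⟩ h
    nlinarith
  · have hd := D.drop_le (K := 2 / γ + 110 * log γ / γ ^ 3)
      (k := lam1 * (1 + slopeBound lam1 c κ (v (1 / 2)))) hr.1 h hr₁.2 (by
      intro s hs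
      have hs' : s ∈ Icc (0:ℝ) 1 := ⟨hr.1.le.trans hs.1.le, hs.2.le.trans hr₁.2⟩
      have h1 := D.expFlux_le_of_half_le hs' (by
        have := D.antitoneOn hs' hr₁' hs.2.le
        linarith)
      have h2 := mul_le_mul D.lam_le_eigen (D.linFlux_le_mul hs') (D.linFlux_nonneg hs')
        D.eigen.lam_nonneg
      unfold flux
      linarith)
    have hlr₁ := log_nonpos hr₁.1.le hr₁.2
    rw [hur] at hd
    have h3 := mul_le_mul_of_nonneg_left hlr₁ hK2
    have h4 : r₁ - r ≤ 1 := by linarith [hr.1, hr₁.2]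
    have h5 := mul_le_mul_of_nonneg_left h4 hk
    linarith

end NearEigen

/-- A bound for the non-logarithmic part of a solution. -/
def heightBound (lam1 c κ m : ℝ) : ℝ := 1 + lam1 * (1 + slopeBound lam1 c κ m)

/-- The radii `ρ₂` and `r'` determining the cut radius `min ρ₂ r'`. -/
structure CutRadii (β γ μ : ℝ) (u : ℝ → ℝ) (ρ₂ r' : ℝ) : Prop where
  pos : 0 < ρ₂
  eq : 1 + ρ₂ ^ 2 / μ ^ 2 = exp (γ ^ 2 - γ)
  of_mem : (β < (γ ^ 2)⁻¹ ∧ (γ ^ 2)⁻¹ < β * exp (γ ^ 2)) →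
    r' ∈ Ioo (0:ℝ) 1 ∧ β * exp ((u r') ^ 2) = (γ ^ 2)⁻¹
  of_not_mem : ¬(β < (γ ^ 2)⁻¹ ∧ (γ ^ 2)⁻¹ < β * exp (γ ^ 2)) → r' = 1

theorem CutRadii.inner_mem {β γ μ ρ₂ r' : ℝ} {u : ℝ → ℝ}
    (C : CutRadii β γ μ u ρ₂ r') : r' ∈ Ioc (0:ℝ) 1 := by
  by_cases h : β < (γ ^ 2)⁻¹ ∧ (γ ^ 2)⁻¹ < β * exp (γ ^ 2)
  · exact Ioo_subset_Ioc_self (C.of_mem h).1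
  · rw [C.of_not_mem h]
    simp

namespace NearEigen

variable {lam β γ μ lam1 c κ ρ₂ r' : ℝ} {u v : ℝ → ℝ}

theorem one_le_heightBound (D : NearEigen lam β γ μ lam1 c κ u v) :
    1 ≤ heightBound lam1 c κ (v (1 / 2)) := by
  have := mul_nonneg D.eigen.lam_nonneg
    (show 0 ≤ 1 + slopeBound lam1 c κ (v (1 / 2)) by linarith [D.one_le_slopeBound])
  unfold heightBound
  linarith

theorem scale_sq_lt (D : NearEigen lam β γ μ lam1 c κ u v) : μ ^ 2 * γ ^ 80 < 4 := by
  have h1 : (1:ℝ) ≤ γ := by linarith [D.large]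
  have h := D.scale_le
  have hμ := D.scale_pos
  have h2 : μ ^ 2 * γ ^ 80 ≤ (μ * γ ^ 50) ^ 2 := by
    rw [mul_pow, ← pow_mul]
    gcongr
    norm_num
  have h3 : (μ * γ ^ 50) ^ 2 ≤ 1 := pow_le_one₀ (by positivity) h
  linarith

theorem exp_neg_div_four_le (D : NearEigen lam β γ μ lam1 c κ u v) :
    exp (-(γ / 4)) ≤ (γ ^ 2)⁻¹ := by
  have hγ := D.center_pos
  have e : (γ ^ 2)⁻¹ = exp (-(2 * log γ)) := by
    rw [exp_neg, mul_comm, exp_mul, exp_log hγ]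
    norm_cast
  rw [e, exp_le_exp]
  linarith [D.log_le, D.one_le_log]

theorem scale_sq_mul_exp (D : NearEigen lam β γ μ lam1 c κ u v) :
    μ ^ 2 * exp (γ ^ 2) * β * γ ^ 2 = 4 := by
  rw [← D.scale_eq]
  ring

theorem outer_sq_eq (D : NearEigen lam β γ μ lam1 c κ u v) (C : CutRadii β γ μ u ρ₂ r') :
    ρ₂ ^ 2 = μ ^ 2 * (exp (γ ^ 2 - γ) - 1) := by
  have hμ := D.scale_pos
  rw [← C.eq]
  field_simp
  ring

theorem cut_le (D : NearEigen lam β γ μ lam1 c κ u v) (C : CutRadii β γ μ u ρ₂ r')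
    (hbig : 4 * (heightBound lam1 c κ (v (1 / 2)) + 3) ^ 2 < γ) :
    min ρ₂ r' ≤ exp (-(γ / 4)) := by
  have hγ := D.center_pos
  have hl := D.large
  have hμ := D.scale_pos
  have hβ := D.beta_pos
  have hs := D.scale_sq_mul_exp
  rcases le_or_gt (exp (-(γ / 2))) β with h | h
  · refine (min_le_left _ _).trans ?_
    have h1 : μ ^ 2 * exp (γ ^ 2) ≤ exp (γ / 2) := by
      have h2 : (4:ℝ) ≤ γ ^ 2 := by nlinarith
      have h3 : μ ^ 2 * exp (γ ^ 2) * β ≤ 1 := by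
        have h4 : 0 ≤ μ ^ 2 * exp (γ ^ 2) * β := by positivity
        nlinarith
      have h4 : μ ^ 2 * exp (γ ^ 2) * exp (-(γ / 2)) ≤ 1 := le_trans (by gcongr) h3
      rw [exp_neg] at h4
      have h5 := exp_pos (γ / 2)
      field_simp at h4
      exact h4
    have h2 : ρ₂ ^ 2 ≤ exp (-(γ / 4)) ^ 2 := by
      rw [D.outer_sq_eq C]
      calc μ ^ 2 * (exp (γ ^ 2 - γ) - 1) ≤ μ ^ 2 * exp (γ ^ 2 - γ) := by
            gcongr
            linarith
        _ = μ ^ 2 * exp (γ ^ 2) * exp (-γ) := by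
            rw [sub_eq_add_neg, exp_add]
            ring
        _ ≤ exp (γ / 2) * exp (-γ) := by gcongr
        _ = exp (-(γ / 4)) ^ 2 := by
            rw [← exp_add, ← exp_nat_mul]
            congr 1
            push_cast
            ring
    exact le_of_sq_le_sq h2 (exp_pos _).le
  · refine (min_le_right _ _).trans ?_
    have hcond : β < (γ ^ 2)⁻¹ ∧ (γ ^ 2)⁻¹ < β * exp (γ ^ 2) := by
      constructor
      · refine h.trans_le (le_trans ?_ D.exp_neg_div_four_le)
        apply exp_le_exp.2
        linarith
      · rw [inv_lt_iff_one_lt_mul₀ (by positivity)]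
        have h1 : μ ^ 2 < 4 := by
          have h2 : (1:ℝ) ≤ γ ^ 80 := one_le_pow₀ (by linarith)
          have := D.scale_sq_lt
          nlinarith [sq_nonneg μ]
        have h2 : μ ^ 2 * (β * exp (γ ^ 2) * γ ^ 2) = 4 := by
          rw [← hs]
          ring
        by_contra! h3
        nlinarith [pow_pos hμ 2]
    obtain ⟨hr, he⟩ := C.of_mem hcond
    by_contra! hlt
    have hu := D.le_add_mul_log ⟨hr.1, hr.2.le⟩
    have hlr : -log r' ≤ γ := by
      have := log_lt_log (exp_pos _) hlt
      rw [log_exp] at this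
      linarith
    have hlr0 : 0 ≤ -log r' := by linarith [log_nonpos hr.1.le hr.2.le]
    have hK : 2 / γ + 110 * log γ / γ ^ 3 ≤ 3 / γ := by
      have h1 : 110 * log γ / γ ^ 3 ≤ 1 / γ := by
        rw [div_le_div_iff₀ (by positivity) hγ]
        have := D.log_le
        have h2 : 110 * log γ ≤ γ ^ 2 := by nlinarith [D.one_le_log]
        nlinarith
      have e : 2 / γ + 1 / γ = 3 / γ := by ring
      linarith
    have hu2 : u r' ≤ heightBound lam1 c κ (v (1 / 2)) + 3 := by
      have h1 : (2 / γ + 110 * log γ / γ ^ 3) * (-log r') ≤ 3 / γ * γ := by gcongr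
      rw [div_mul_cancel₀ _ hγ.ne'] at h1
      unfold heightBound
      linarith
    have hu0 := D.nonneg (Ioo_subset_Icc_self hr)
    have hu3 : u r' ^ 2 < γ / 4 := by
      have : u r' ^ 2 ≤ (heightBound lam1 c κ (v (1 / 2)) + 3) ^ 2 := by gcongr
      linarith
    have h4 : β * exp ((u r') ^ 2) < (γ ^ 2)⁻¹ := by
      calc β * exp ((u r') ^ 2) < exp (-(γ / 2)) * exp (γ / 4) := by gcongr
        _ = exp (-(γ / 4)) := by
            rw [← exp_add]
            congr 1
            ring
        _ ≤ _ := D.exp_neg_div_four_le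
    linarith

theorem le_cut (D : NearEigen lam β γ μ lam1 c κ u v) (C : CutRadii β γ μ u ρ₂ r') :
    μ * γ ≤ min ρ₂ r' := by
  have hγ := D.center_pos
  have hl := D.large
  have hμ := D.scale_pos
  have hβ := D.beta_pos
  have hs := D.scale_sq_mul_exp
  refine le_min ?_ ?_
  · refine le_of_sq_le_sq ?_ C.pos.le
    rw [D.outer_sq_eq C, mul_pow]
    gcongr
    have h1 : 2 * γ ≤ γ ^ 2 - γ := by nlinarith
    have := quadratic_le_exp_of_nonneg (show 0 ≤ γ ^ 2 - γ by linarith)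
    nlinarith
  · by_cases h : β < (γ ^ 2)⁻¹ ∧ (γ ^ 2)⁻¹ < β * exp (γ ^ 2)
    · obtain ⟨hr, he⟩ := C.of_mem h
      by_contra! hlt
      have hR1 : μ * γ ≤ 1 := D.scale_mul_le.trans D.scale_mul_pow_le_one
      have h1 := D.sub_le D.scale_le_scale_mul D.scale_mul_le
      have h2 := D.antitoneOn (Ioo_subset_Icc_self hr) ⟨(mul_pos hμ hγ).le, hR1⟩ hlt.le
      have h3 := D.forty_mul_log_div_le
      have h4 : γ ^ 2 - 80 * log γ ≤ u r' ^ 2 := by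
        have h5 : 0 ≤ γ - 40 * log γ / γ := by linarith
        calc γ ^ 2 - 80 * log γ ≤ γ ^ 2 - 80 * log γ + (40 * log γ / γ) ^ 2 := by
              linarith [sq_nonneg (40 * log γ / γ)]
          _ = (γ - 40 * log γ / γ) ^ 2 := by
              field_simp
              ring
          _ ≤ _ := by
              have := h1.trans h2
              gcongr
      have h5 : exp (γ ^ 2) ≤ exp ((u r') ^ 2) * γ ^ 80 := by
        have e : γ ^ 80 = exp (80 * log γ) := by
          rw [mul_comm, exp_mul, exp_log hγ]
          norm_cast
        rw [e, ← exp_add]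
        apply exp_le_exp.2
        linarith
      have h6 : 4 ≤ μ ^ 2 * γ ^ 80 := by
        calc 4 = μ ^ 2 * exp (γ ^ 2) * β * γ ^ 2 := hs.symm
          _ ≤ μ ^ 2 * (exp ((u r') ^ 2) * γ ^ 80) * β * γ ^ 2 := by gcongr
          _ = μ ^ 2 * γ ^ 80 * (β * exp ((u r') ^ 2)) * γ ^ 2 := by ring
          _ = μ ^ 2 * γ ^ 80 := by
              rw [he]
              field_simp
      linarith [D.scale_sq_lt]
    · rw [C.of_not_mem h]
      exact D.scale_mul_le.trans D.scale_mul_pow_le_one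

theorem log_outer (D : NearEigen lam β γ μ lam1 c κ u v) (C : CutRadii β γ μ u ρ₂ r') :
    γ ^ 2 - γ - 1 ≤ 2 * (log ρ₂ - log μ) ∧ 2 * (log ρ₂ - log μ) ≤ γ ^ 2 - γ := by
  have hl := D.large
  have hμ := D.scale_pos
  have h := D.outer_sq_eq C
  have hx : 1 ≤ γ ^ 2 - γ := by nlinarith
  have h1 : 1 + 1 ≤ exp (γ ^ 2 - γ) := by linarith [add_one_le_exp (γ ^ 2 - γ)]
  have h2 : 2 * (log ρ₂ - log μ) = log (exp (γ ^ 2 - γ) - 1) := by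
    have h3 := congrArg log h
    rw [log_pow, log_mul (by positivity) (by linarith), log_pow] at h3
    push_cast at h3
    linarith
  rw [h2]
  constructor
  · rw [le_log_iff_exp_le (by linarith), exp_sub]
    have h4 := add_one_le_exp (1:ℝ)
    rw [div_le_iff₀ (exp_pos _)]
    nlinarith
  · rw [log_le_iff_le_exp (by linarith)]
    linarith

theorem half_le_cut (D : NearEigen lam β γ μ lam1 c κ u v) (C : CutRadii β γ μ u ρ₂ r')
    (hbig : 4 * (heightBound lam1 c κ (v (1 / 2)) + 3) ^ 2 < γ) :
    1 / 2 ≤ u (min ρ₂ r') := by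
  have hγ := D.center_pos
  have hl := D.large
  have hμ := D.scale_pos
  have hL := D.one_le_log
  have hR : 0 < μ * γ := mul_pos hμ hγ
  have hR1 : μ * γ ≤ 1 := D.scale_mul_le.trans D.scale_mul_pow_le_one
  have hsm := D.forty_mul_log_div_le
  have huR := D.sub_le D.scale_le_scale_mul D.scale_mul_le
  have hcut := D.cut_le C hbig
  have hle := D.le_cut C
  have hρ1 : min ρ₂ r' ≤ 1 := (min_le_right _ _).trans C.inner_mem.2
  set ρ := min ρ₂ r' with hρ
  have hρ0 : 0 < ρ := hR.trans_le hle
  by_contra! hlt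
  obtain ⟨r, hr, hur⟩ := D.exists_eq (c := 1 / 2) (by norm_num) (by linarith)
  have hrρ : r ≤ ρ := by
    by_contra! h
    have := D.antitoneOn ⟨hρ0.le, hρ1⟩ hr h.le
    linarith
  have hRr : μ * γ ≤ r := by
    by_contra! h
    have := D.antitoneOn hr ⟨hR.le, hR1⟩ h.le
    linarith
  have hr0 : 0 < r := hR.trans_le hRr
  have hd := D.drop_le (K := 2 / γ + 110 * log γ / γ ^ 3)
      (k := lam1 * (1 + slopeBound lam1 c κ (v (1 / 2)))) hR hRr hr.2 (by
      intro s hs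
      have hs' : s ∈ Icc (0:ℝ) 1 := ⟨hR.le.trans hs.1.le, hs.2.le.trans hr.2⟩
      have h1 := D.expFlux_le_of_half_le hs' (by
        have := D.antitoneOn hs' hr hs.2.le
        linarith)
      have h2 := mul_le_mul D.lam_le_eigen (D.linFlux_le_mul hs') (D.linFlux_nonneg hs')
        D.eigen.lam_nonneg
      unfold flux
      linarith)
  have hlog : log r - log (μ * γ) ≤ (γ ^ 2 - γ) / 2 := by
    have h1 := (D.log_outer C).2
    have h2 : log r ≤ log ρ₂ := log_le_log hr0 (hrρ.trans (min_le_left _ _))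
    rw [log_mul hμ.ne' hγ.ne']
    linarith
  have h1 : (2 / γ + 110 * log γ / γ ^ 3) * (log r - log (μ * γ))
      ≤ γ - 1 + 55 * log γ / γ := by
    calc (2 / γ + 110 * log γ / γ ^ 3) * (log r - log (μ * γ))
        ≤ (2 / γ + 110 * log γ / γ ^ 3) * ((γ ^ 2 - γ) / 2) := by gcongr
      _ = γ - 1 + 55 * log γ / γ - 55 * log γ / γ ^ 2 := by
          field_simp
          ring
      _ ≤ _ := by
          have : 0 ≤ 55 * log γ / γ ^ 2 := by positivity
          linarith
  have hk : lam1 * (1 + slopeBound lam1 c κ (v (1 / 2))) * (r - μ * γ) ≤ 1 / γ := by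
    have h2 := D.one_le_heightBound
    have h3 : lam1 * (1 + slopeBound lam1 c κ (v (1 / 2))) ≤ γ := by
      unfold heightBound at hbig h2
      nlinarith
    have h4 : r - μ * γ ≤ (γ ^ 2)⁻¹ := by
      have := D.exp_neg_div_four_le
      linarith
    calc _ ≤ γ * (γ ^ 2)⁻¹ := by
          apply mul_le_mul h3 h4 (by linarith) hγ.le
      _ = 1 / γ := by field_simp
  have h5 : 1 / γ ≤ 1 / 1000 := by
    rw [div_le_div_iff₀ hγ (by norm_num)]
    linarith
  have h6 : 55 * log γ / γ = 11 / 8 * (40 * log γ / γ) := by ring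
  rw [hur] at hd
  linarith

theorem outer_value_le (D : NearEigen lam β γ μ lam1 c κ u v) (C : CutRadii β γ μ u ρ₂ r')
    (h1 : ρ₂ ≤ 1) : u ρ₂ ≤ 2 := by
  have hγ := D.center_pos
  have hl := D.large
  have hμ := D.scale_pos
  have hL := D.one_le_log
  have hR : 0 < μ * γ := mul_pos hμ hγ
  have hle := (D.le_cut C).trans (min_le_left _ _)
  have hd := D.drop_outer hle h1
  have hc := D.le_center ⟨hR.le, hle.trans h1⟩
  have hlog : (γ ^ 2 - γ - 1) / 2 - log γ ≤ log ρ₂ - log (μ * γ) := by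
    have h1 := (D.log_outer C).1
    rw [log_mul hμ.ne' hγ.ne']
    linarith
  have h240 : 0 ≤ 2 / γ - 240 / γ ^ 3 := by
    rw [sub_nonneg, div_le_div_iff₀ (by positivity) hγ]
    have : (120:ℝ) ≤ γ ^ 2 := by nlinarith
    nlinarith
  have h2 := mul_le_mul_of_nonneg_left hlog h240
  have e : (2 / γ - 240 / γ ^ 3) * ((γ ^ 2 - γ - 1) / 2 - log γ)
      = γ - 1 - 1 / γ - 2 * log γ / γ - 120 / γ + 240 / γ ^ 3 * ((γ + 1) / 2 + log γ) := by
    field_simp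
    ring
  have h3 : 0 ≤ 240 / γ ^ 3 * ((γ + 1) / 2 + log γ) := by positivity
  have h4 := D.forty_mul_log_div_le
  have h5 : 121 / γ ≤ 1 / 1000 := by
    rw [div_le_div_iff₀ hγ (by norm_num)]
    linarith
  have e2 : 2 * log γ / γ = 1 / 20 * (40 * log γ / γ) := by ring
  have e3 : 1 / γ + 120 / γ = 121 / γ := by ring
  linarith

theorem exp_cut_le (D : NearEigen lam β γ μ lam1 c κ u v) (C : CutRadii β γ μ u ρ₂ r')
    (hbig : 4 * (heightBound lam1 c κ (v (1 / 2)) + 3) ^ 2 < γ) :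
    β * exp ((u (min ρ₂ r')) ^ 2) ≤ (γ ^ 2)⁻¹ + exp 4 * κ / γ := by
  have hγ := D.center_pos
  have hκ := D.gap_pos
  have hcut := D.cut_le C hbig
  have hβ := D.beta_le
  have hβ0 := D.beta_pos
  have hlt : exp (-(γ / 4)) < 1 := exp_lt_one_iff.2 (by linarith)
  rcases min_choice ρ₂ r' with h | h
  · rw [h] at hcut ⊢
    have h1 : ρ₂ ≤ 1 := hcut.trans hlt.le
    have h2 := D.outer_value_le C h1
    have h3 := D.nonneg ⟨C.pos.le, h1⟩
    have h4 : u ρ₂ ^ 2 ≤ 4 := by nlinarith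
    have h5 : 0 ≤ (γ ^ 2)⁻¹ := by positivity
    calc β * exp ((u ρ₂) ^ 2) ≤ κ / γ * exp 4 := by gcongr
      _ = exp 4 * κ / γ := by ring
      _ ≤ _ := by linarith
  · rw [h] at hcut ⊢
    by_cases h1 : β < (γ ^ 2)⁻¹ ∧ (γ ^ 2)⁻¹ < β * exp (γ ^ 2)
    · rw [(C.of_mem h1).2]
      have : 0 ≤ exp 4 * κ / γ := by positivity
      linarith
    · rw [C.of_not_mem h1] at hcut
      linarith

end NearEigen

theorem abs_le_of_abs_hasDerivAt_le {f f' g g' : ℝ → ℝ} {a b : ℝ} (hab : a ≤ b)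
    (hf : ContinuousOn f (Icc a b)) (hg : ContinuousOn g (Icc a b))
    (hfd : ∀ x ∈ Ioo a b, HasDerivAt f (f' x) x) (hgd : ∀ x ∈ Ioo a b, HasDerivAt g (g' x) x)
    (h : ∀ x ∈ Ioo a b, |f' x| ≤ g' x) (ha : |f a| ≤ g a) : |f b| ≤ g b := by
  have h1 := le_of_hasDerivAt_nonneg (f := fun x => g x - f x) (f' := fun x => g' x - f' x) hab
    (hg.sub hf) (fun x hx => (hgd x hx).sub (hfd x hx))
    (fun x hx => by linarith [(abs_le.1 (h x hx)).2])
  have h2 := le_of_hasDerivAt_nonneg (f := fun x => g x + f x) (f' := fun x => g' x + f' x) hab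
    (hg.add hf) (fun x hx => (hgd x hx).add (hfd x hx))
    (fun x hx => by linarith [(abs_le.1 (h x hx)).1])
  have := abs_le.1 ha
  rw [abs_le]
  constructor <;> linarith

/-- A Volterra inequality `|z| ≤ E + k ∫ |z|` yields an exponential bound. -/
theorem abs_le_mul_exp_of_abs_le_add_integral {z : ℝ → ℝ} {a b E k : ℝ} (hz : Continuous z)
    (hk : 0 ≤ k) (hab : a ≤ b)
    (h : ∀ r ∈ Icc a b, |z r| ≤ E + k * ∫ s in a..r, |z s|) : |z b| ≤ E * exp (k * (b - a)) := by
  have hY : ∀ x, HasDerivAt (fun r => ∫ s in a..r, |z s|) |z x| x := fun x =>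
    (hz.abs.integral_hasStrictDerivAt a x).hasDerivAt
  have hexp : ∀ x, HasDerivAt (fun r => exp (-(k * (r - a)))) (exp (-(k * (x - a))) * (-k)) x := by
    intro x
    have := ((((hasDerivAt_id x).sub_const a).const_mul k).neg).exp
    exact this.congr_deriv (by simp)
  have hd : ∀ x, HasDerivAt
      (fun r => -((E + k * ∫ s in a..r, |z s|) * exp (-(k * (r - a)))))
      (-(k * |z x| * exp (-(k * (x - a)))
        + (E + k * ∫ s in a..x, |z s|) * (exp (-(k * (x - a))) * (-k)))) x := fun x =>
    ((((hY x).const_mul k).const_add E).mul (hexp x)).neg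
  have key := le_of_hasDerivAt_nonneg hab
    (fun x _ => (hd x).continuousAt.continuousWithinAt) (fun x _ => hd x) (by
      intro x hx
      have h1 := h x (Ioo_subset_Icc_self hx)
      have h2 := mul_nonneg (mul_nonneg hk (exp_pos (-(k * (x - a)))).le) (sub_nonneg.2 h1)
      linarith)
  simp only [intervalIntegral.integral_same, mul_zero, add_zero, sub_self, neg_zero, exp_zero,
    mul_one, neg_le_neg_iff] at key
  rw [exp_neg, ← div_eq_mul_inv, div_le_iff₀ (exp_pos _)] at key
  exact (h b ⟨hab, le_rfl⟩).trans key

/-- The error in the expansion away from the concentration point. -/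
def expansionError (lam1 c κ m γ : ℝ) : ℝ :=
  240 * log γ / γ
    + (heightBound lam1 c κ m + (heightBound lam1 c κ m + 1) / m * lam1 * c)
      * (γ ^ 2 * exp (-(γ / 4)))
    + (lam1 * (2 / γ)
      + ((γ ^ 2)⁻¹ + exp 4 * κ / γ + κ / γ) * (1 + slopeBound lam1 c κ m))

/-- The coefficient of `v` matched at the radius `ρ`. -/
def matchCoeff (γ : ℝ) (u v : ℝ → ℝ) (ρ : ℝ) : ℝ := (u ρ + 2 / γ * log ρ) / v ρ

namespace NearEigen

variable {lam β γ μ lam1 c κ : ℝ} {u v : ℝ → ℝ}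

theorem neg_log_le_sq (D : NearEigen lam β γ μ lam1 c κ u v) {ρ : ℝ} (hle : μ * γ ≤ ρ)
    (hρ1 : ρ ≤ 1) : -log ρ ≤ γ ^ 2 := by
  have hR : 0 < μ * γ := mul_pos D.scale_pos D.center_pos
  have h1 := D.log_sub_log_le_sq (r := 1) (hle.trans hρ1) le_rfl
  have h2 := log_le_log hR hle
  rw [log_one] at h1
  linarith

theorem le_matchCoeff (D : NearEigen lam β γ μ lam1 c κ u v) {ρ : ℝ} (hle : μ * γ ≤ ρ)
    (hρ : ρ ≤ 1 / 2) : -(240 / (γ * v (1 / 2))) ≤ matchCoeff γ u v ρ := by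
  have hγ := D.center_pos
  have hm := D.half_pos
  have hR : 0 < μ * γ := mul_pos D.scale_pos D.center_pos
  have hρ0 : 0 < ρ := hR.trans_le hle
  have hlog := D.neg_log_le_sq hle (by linarith)
  have hv : v (1 / 2) ≤ v ρ :=
    D.eigen.antitoneOn ⟨hρ0.le, by linarith⟩ (by norm_num) hρ
  have hd := D.le_drop (K := 2 / γ - 240 / γ ^ 3) hρ0 (by linarith : ρ ≤ 1) le_rfl (by
    intro s hs
    exact (D.le_expFlux_outer (hle.trans hs.1.le) hs.2.le).trans
      (D.expFlux_le_flux ⟨hρ0.le.trans hs.1.le, hs.2.le⟩))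
  rw [D.one, log_one] at hd
  have h1 : 240 / γ ^ 3 * (-log ρ) ≤ 240 / γ := by
    calc 240 / γ ^ 3 * (-log ρ) ≤ 240 / γ ^ 3 * γ ^ 2 := by gcongr
      _ = 240 / γ := by field_simp
  unfold matchCoeff
  rw [le_div_iff₀ (hm.trans_le hv)]
  have h2 : 240 / γ ≤ 240 / (γ * v (1 / 2)) * v ρ := by
    calc 240 / γ = 240 / (γ * v (1 / 2)) * v (1 / 2) := by field_simp
      _ ≤ _ := by gcongr
  linarith

theorem abs_matchCoeff_le (D : NearEigen lam β γ μ lam1 c κ u v) {ρ : ℝ} (hle : μ * γ ≤ ρ)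
    (hρ : ρ ≤ 1 / 2) :
    |matchCoeff γ u v ρ| ≤ (heightBound lam1 c κ (v (1 / 2)) + 1) / v (1 / 2) := by
  have hγ := D.center_pos
  have hl := D.large
  have hm := D.half_pos
  have hH := D.one_le_heightBound
  have hL := D.one_le_log
  have hR : 0 < μ * γ := mul_pos D.scale_pos D.center_pos
  have hρ0 : 0 < ρ := hR.trans_le hle
  have hlog := D.neg_log_le_sq hle (by linarith)
  have hv : v (1 / 2) ≤ v ρ :=
    D.eigen.antitoneOn ⟨hρ0.le, by linarith⟩ (by norm_num) hρ
  rw [abs_le]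
  constructor
  · refine le_trans ?_ (D.le_matchCoeff hle hρ)
    rw [neg_le_neg_iff, ← div_div]
    have : 240 / γ ≤ 1 := by
      rw [div_le_one hγ]
      linarith
    gcongr
    linarith
  · have hu := D.le_add_mul_log ⟨hρ0, by linarith⟩
    have h1 : 110 * log γ / γ ^ 3 * (-log ρ) ≤ 1 := by
      calc 110 * log γ / γ ^ 3 * (-log ρ) ≤ 110 * log γ / γ ^ 3 * γ ^ 2 := by gcongr
        _ = 11 / 4 * (40 * log γ / γ) := by
            field_simp
            norm_num
        _ ≤ 1 := by linarith [D.forty_mul_log_div_le]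
    unfold matchCoeff
    rw [div_le_iff₀ (hm.trans_le hv)]
    have h2 : u ρ + 2 / γ * log ρ ≤ heightBound lam1 c κ (v (1 / 2)) + 1 := by
      unfold heightBound
      linarith
    refine h2.trans ?_
    rw [div_mul_eq_mul_div, le_div_iff₀ hm]
    gcongr

theorem abs_flux_sub_le (D : NearEigen lam β γ μ lam1 c κ u v) {ρ A a : ℝ}
    (hle : μ * γ ≤ ρ) (hρ1 : ρ ≤ 1) (hhalf : 1 / 2 ≤ u ρ) (ha0 : 0 ≤ a) (hA : |A| ≤ a) :
    |flux lam β u ρ - 2 / γ - A * flux lam1 0 v ρ|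
      ≤ 240 * log γ / γ ^ 3 + (heightBound lam1 c κ (v (1 / 2)) + a * lam1 * c) * ρ := by
  have hγ := D.center_pos
  have hc := D.eigen.center_pos
  have hlam1 := D.eigen.lam_nonneg
  have hL := D.one_le_log
  have hρ0 : 0 < ρ := (mul_pos D.scale_pos hγ).trans_le hle
  have hρ : ρ ∈ Icc (0:ℝ) 1 := ⟨hρ0.le, hρ1⟩
  have h3 : |expFlux β u ρ - 2 / γ| ≤ 240 * log γ / γ ^ 3 := by
    have h1 := D.le_expFlux_outer hle hρ1
    have h2 := D.expFlux_le_of_half_le hρ hhalf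
    have h4 : 240 / γ ^ 3 ≤ 240 * log γ / γ ^ 3 := by
      gcongr
      linarith
    have h5 : 110 * log γ / γ ^ 3 ≤ 240 * log γ / γ ^ 3 := by
      gcongr
      norm_num
    rw [abs_le]
    constructor <;> linarith
  have h4 : |lam * linFlux u ρ| ≤ heightBound lam1 c κ (v (1 / 2)) * ρ := by
    have h5 := D.linFlux_nonneg hρ
    rw [abs_of_nonneg (mul_nonneg D.lam_nonneg h5)]
    have h6 := mul_le_mul D.lam_le_eigen (D.linFlux_le_mul hρ) h5 hlam1
    unfold heightBound
    linarith
  have h5 : |A * flux lam1 0 v ρ| ≤ a * lam1 * c * ρ := by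
    have h6 : flux lam1 0 v ρ = lam1 * linFlux v ρ := by
      simp [flux, expFlux]
    have h7 := D.eigen.linFlux_nonneg hρ
    have h8 : linFlux v ρ ≤ c * ρ := by
      have h8 := D.eigen.linFlux_le hρ
      have h9 : c * ρ ^ 2 ≤ c * ρ := by
        gcongr
        nlinarith
      have h10 : 0 ≤ c * ρ ^ 2 := by positivity
      linarith
    rw [h6, abs_mul, abs_of_nonneg (mul_nonneg hlam1 h7)]
    calc |A| * (lam1 * linFlux v ρ) ≤ a * (lam1 * (c * ρ)) := by gcongr
      _ = _ := by ring
  have h6 : flux lam β u ρ - 2 / γ - A * flux lam1 0 v ρ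
      = (expFlux β u ρ - 2 / γ) + lam * linFlux u ρ - A * flux lam1 0 v ρ := by
    unfold flux
    ring
  rw [h6]
  refine (abs_sub _ _).trans ?_
  have := abs_add_le (expFlux β u ρ - 2 / γ) (lam * linFlux u ρ)
  linarith

theorem abs_source_le (D : NearEigen lam β γ μ lam1 c κ u v) {ρ y : ℝ} (hρ0 : 0 < ρ)
    (hβρ : β * exp ((u ρ) ^ 2) ≤ (γ ^ 2)⁻¹ + exp 4 * κ / γ) (hρy : ρ ≤ y) (hy1 : y ≤ 1) (w : ℝ) :
    |y * (lam1 * w + lam1 * (2 / γ) * (-log y) + (β * exp ((u y) ^ 2) - κ / γ) * u y)|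
      ≤ y * (lam1 * |w|) + (lam1 * (2 / γ)
        + ((γ ^ 2)⁻¹ + exp 4 * κ / γ + κ / γ) * (1 + slopeBound lam1 c κ (v (1 / 2)))) := by
  have hγ := D.center_pos
  have hκ := D.gap_pos
  have hlam1 := D.eigen.lam_nonneg
  set K := slopeBound lam1 c κ (v (1 / 2)) with hKdef
  have hK : 1 ≤ K := D.one_le_slopeBound
  set η := (γ ^ 2)⁻¹ + exp 4 * κ / γ + κ / γ with hη
  have hη0 : 0 ≤ η := by positivity
  have hy0 : 0 < y := hρ0.trans_le hρy
  have hyI : y ∈ Icc (0:ℝ) 1 := ⟨hy0.le, hy1⟩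
  have h1 := D.nonneg hyI
  have h2 : y * (-log y) ≤ 1 := neg_mul_log_le_one hy0
  have h2' : 0 ≤ y * (-log y) := mul_nonneg hy0.le (by linarith [log_nonpos hy0.le hy1])
  have h3 : |β * exp ((u y) ^ 2) - κ / γ| ≤ η := by
    have h4 : β * exp ((u y) ^ 2) ≤ β * exp ((u ρ) ^ 2) := by
      have := D.antitoneOn ⟨hρ0.le, hρy.trans hy1⟩ hyI hρy
      have := D.beta_nonneg
      gcongr
    have h5 : 0 ≤ β * exp ((u y) ^ 2) := mul_nonneg D.beta_nonneg (exp_pos _).le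
    have h6 : 0 ≤ κ / γ := by positivity
    have h7 : 0 ≤ (γ ^ 2)⁻¹ + exp 4 * κ / γ := by positivity
    rw [abs_le]
    constructor <;> linarith
  have h4 : y * u y ≤ 1 + K := by
    have h5 := mul_le_mul_of_nonneg_left (D.le_one_add_slopeBound_mul ⟨hy0, hy1⟩) hy0.le
    have h6 := mul_le_mul_of_nonneg_left h2 (zero_le_one.trans hK)
    rw [← hKdef] at h5
    linarith
  have e1 : y * (lam1 * w + lam1 * (2 / γ) * (-log y) + (β * exp ((u y) ^ 2) - κ / γ) * u y)
      = y * (lam1 * w) + lam1 * (2 / γ) * (y * (-log y))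
        + (β * exp ((u y) ^ 2) - κ / γ) * (y * u y) := by ring
  have h5 : |y * (lam1 * w)| = y * (lam1 * |w|) := by
    rw [abs_mul, abs_mul, abs_of_pos hy0, abs_of_nonneg hlam1]
  have h6 : |lam1 * (2 / γ) * (y * (-log y))| ≤ lam1 * (2 / γ) := by
    rw [abs_of_nonneg (by positivity)]
    exact mul_le_of_le_one_right (by positivity) h2
  have h7 : |(β * exp ((u y) ^ 2) - κ / γ) * (y * u y)| ≤ η * (1 + K) := by
    rw [abs_mul, abs_of_nonneg (mul_nonneg hy0.le h1)]
    gcongr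
  rw [e1]
  refine (abs_add_three _ _ _).trans ?_
  linarith

/-- Expansion of the solution away from the concentration point. -/
theorem abs_sub_matchCoeff_mul_le (D : NearEigen lam β γ μ lam1 c κ u v) {ρ : ℝ}
    (hle : μ * γ ≤ ρ) (hρ : ρ ≤ exp (-(γ / 4))) (hhalf : 1 / 2 ≤ u ρ)
    (hβρ : β * exp ((u ρ) ^ 2) ≤ (γ ^ 2)⁻¹ + exp 4 * κ / γ) {r : ℝ} (hr : r ∈ Icc ρ 1) :
    |u r + 2 / γ * log r - matchCoeff γ u v ρ * v r|
      ≤ expansionError lam1 c κ (v (1 / 2)) γ * exp lam1 := by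
  have hγ := D.center_pos
  have hl := D.large
  have hm := D.half_pos
  have hκ := D.gap_pos
  have hc := D.eigen.center_pos
  have hlam1 := D.eigen.lam_nonneg
  have hH := D.one_le_heightBound
  have hK := D.one_le_slopeBound
  have hL := D.one_le_log
  have hR : 0 < μ * γ := mul_pos D.scale_pos D.center_pos
  have hρ0 : 0 < ρ := hR.trans_le hle
  have hρh : ρ ≤ 1 / 2 := by
    refine hρ.trans (D.exp_neg_div_four_le.trans ?_)
    rw [inv_le_comm₀ (by positivity) (by norm_num)]
    nlinarith
  have hρ1 : ρ ≤ 1 := by linarith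
  have hlog := D.neg_log_le_sq hle hρ1
  have hlog0 : 0 ≤ -log ρ := by linarith [log_nonpos hρ0.le hρ1]
  have hA := D.abs_matchCoeff_le hle hρh
  have hvρ : 0 < v ρ := D.eigen.pos ρ ⟨hρ0.le, by linarith⟩
  have hAv : matchCoeff γ u v ρ * v ρ = u ρ + 2 / γ * log ρ := div_mul_cancel₀ _ hvρ.ne'
  set A := matchCoeff γ u v ρ with hAdef
  set H := heightBound lam1 c κ (v (1 / 2)) with hHdef
  set K := slopeBound lam1 c κ (v (1 / 2)) with hKdef
  set a := (H + 1) / v (1 / 2) with ha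
  set η := (γ ^ 2)⁻¹ + exp 4 * κ / γ + κ / γ with hη
  set b := lam1 * (2 / γ) + η * (1 + K) with hb
  set e := 240 * log γ / γ ^ 3 + (H + a * lam1 * c) * ρ with he
  have hη0 : 0 ≤ η := by positivity
  have hb0 : 0 ≤ b := by positivity
  have ha0 : 0 ≤ a := by positivity
  have he0 : 0 ≤ e := by positivity
  have hu := D.cont
  have hv := D.eigen.cont
  have hFu := continuous_flux hu lam β
  have hFv := continuous_flux hv lam1 0
  set z : ℝ → ℝ := fun x => u x + 2 / γ * log (max x ρ) - A * v x with hz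
  have hzc : Continuous z := by
    have : Continuous (fun x : ℝ => log (max x ρ)) :=
      Continuous.log (by fun_prop) (fun x => (hρ0.trans_le (le_max_right _ _)).ne')
    fun_prop
  have hzeq : ∀ x, ρ ≤ x → z x = u x + 2 / γ * log x - A * v x := by
    intro x hx
    simp only [hz, max_eq_left hx]
  have hzρ : z ρ = 0 := by
    rw [hzeq ρ le_rfl, hAv]
    ring
  have hY : ∀ x, HasDerivAt (fun r => ∫ s in ρ..r, |z s|) |z x| x := fun x =>
    (hzc.abs.integral_hasStrictDerivAt ρ x).hasDerivAt
  have hYc : Continuous (fun r => ∫ s in ρ..r, |z s|) :=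
    continuous_iff_continuousAt.2 fun x => (hY x).continuousAt
  have hY0 : ∀ x, ρ ≤ x → 0 ≤ ∫ s in ρ..x, |z s| := fun x hx =>
    intervalIntegral.integral_nonneg hx fun _ _ => abs_nonneg _
  set G : ℝ → ℝ := fun x => flux lam β u x - 2 / γ - A * flux lam1 0 v x with hG
  have hGρ : |G ρ| ≤ e := D.abs_flux_sub_le hle hρ1 hhalf ha0 hA
  have hGd : ∀ x ∈ Ioo ρ 1, HasDerivAt G
      (x * (lam1 * z x + lam1 * (2 / γ) * (-log x)
        + (β * exp ((u x) ^ 2) - κ / γ) * u x)) x := by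
    intro x hx
    have h1 := ((hasDerivAt_flux hu lam β x).sub_const (2 / γ)).sub
      ((hasDerivAt_flux hv lam1 0 x).const_mul A)
    refine h1.congr_deriv ?_
    rw [hzeq x hx.1.le, ← D.gap_eq]
    ring
  have hGle : ∀ x ∈ Icc ρ 1, |G x| ≤ e + x * (lam1 * (∫ s in ρ..x, |z s|) + b) := by
    intro x hx
    refine abs_le_of_abs_hasDerivAt_le
      (g := fun x => e + x * (lam1 * (∫ s in ρ..x, |z s|) + b))
      (g' := fun x => 1 * (lam1 * (∫ s in ρ..x, |z s|) + b) + x * (lam1 * |z x|)) hx.1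
      (by fun_prop) (by fun_prop) (fun y hy => hGd y ⟨hy.1, hy.2.trans_le hx.2⟩)
      (fun y _ => ((hasDerivAt_id y).mul (((hY y).const_mul lam1).add_const b)).const_add e)
      ?_ ?_
    · intro y hy
      have h1 := D.abs_source_le hρ0 hβρ hy.1.le (hy.2.le.trans hx.2) (z y)
      have h2 := mul_nonneg hlam1 (hY0 y hy.1.le)
      linarith
    · have : 0 ≤ ρ * b := by positivity
      simp only [intervalIntegral.integral_same, mul_zero, zero_add]
      linarith
  have hzd : ∀ x ∈ Ioo ρ 1, HasDerivAt z (-(G x) / x) x := by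
    intro x hx
    have hx0 : 0 < x := hρ0.trans hx.1
    have hx' : x ∈ Ioo (0:ℝ) 1 := ⟨hx0, hx.2⟩
    have h1 := ((D.hasDerivAt x hx').add ((Real.hasDerivAt_log hx0.ne').const_mul (2 / γ))).sub
      ((D.eigen.hasDerivAt x hx').const_mul A)
    refine (h1.congr_of_eventuallyEq ?_).congr_deriv ?_
    · filter_upwards [Ioi_mem_nhds hx.1] with y hy
      exact hzeq y (le_of_lt hy)
    · simp only [hG]
      field_simp
      ring
  have hzle : ∀ x ∈ Icc ρ 1, |z x| ≤ (e * (-log ρ) + b) + lam1 * ∫ s in ρ..x, |z s| := by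
    intro x hx
    have hx0 : 0 < x := hρ0.trans_le hx.1
    have h1 := abs_le_of_abs_hasDerivAt_le (f := z)
      (g := fun x => e * (log x - log ρ) + x * (b + lam1 * (∫ s in ρ..x, |z s|)))
      (g' := fun x => e * x⁻¹ + (1 * (b + lam1 * (∫ s in ρ..x, |z s|)) + x * (lam1 * |z x|)))
      hx.1 hzc.continuousOn ?_ (fun y hy => hzd y ⟨hy.1, hy.2.trans_le hx.2⟩) ?_ ?_ ?_
    · refine h1.trans ?_
      have h2 := log_nonpos hx0.le hx.2
      have h3 : 0 ≤ b + lam1 * ∫ s in ρ..x, |z s| :=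
        add_nonneg hb0 (mul_nonneg hlam1 (hY0 x hx.1))
      have h4 : x * (b + lam1 * ∫ s in ρ..x, |z s|) ≤ 1 * (b + lam1 * ∫ s in ρ..x, |z s|) :=
        mul_le_mul_of_nonneg_right hx.2 h3
      have h5 := mul_le_mul_of_nonneg_left h2 he0
      linarith
    · refine (continuousOn_const.mul ((continuousOn_log.mono ?_).sub continuousOn_const)).add
        (by fun_prop)
      intro y hy
      exact (hρ0.trans_le hy.1).ne'
    · intro y hy
      have hy0 : 0 < y := hρ0.trans hy.1
      exact (((Real.hasDerivAt_log hy0.ne').sub_const _).const_mul e).add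
        ((hasDerivAt_id y).mul (((hY y).const_mul lam1).const_add b))
    · intro y hy
      have hy0 : 0 < y := hρ0.trans hy.1
      have h2 := hGle y ⟨hy.1.le, hy.2.le.trans hx.2⟩
      rw [abs_div, abs_neg, abs_of_pos hy0, div_le_iff₀ hy0]
      have h3 : 0 ≤ y * (lam1 * |z y|) := by positivity
      have h4 : (e * y⁻¹ + (1 * (b + lam1 * (∫ s in ρ..y, |z s|)) + y * (lam1 * |z y|))) * y
          = e + y * (lam1 * (∫ s in ρ..y, |z s|) + b) + y * (lam1 * |z y|) * y := by
        field_simp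
        ring
      rw [h4]
      have := mul_nonneg h3 hy0.le
      linarith
    · rw [hzρ]
      simp only [abs_zero, sub_self, mul_zero, zero_add, intervalIntegral.integral_same, add_zero]
      positivity
  have hfin := abs_le_mul_exp_of_abs_le_add_integral hzc hlam1 hr.1
    (fun x hx => hzle x ⟨hx.1, hx.2.trans hr.2⟩)
  rw [hzeq r hr.1] at hfin
  refine hfin.trans ?_
  have hE : e * (-log ρ) + b ≤ expansionError lam1 c κ (v (1 / 2)) γ := by
    have h1 : e * (-log ρ) ≤ (240 * log γ / γ ^ 3 + (H + a * lam1 * c) * exp (-(γ / 4))) * γ ^ 2 := by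
      rw [he]
      gcongr
    have h2 : (240 * log γ / γ ^ 3 + (H + a * lam1 * c) * exp (-(γ / 4))) * γ ^ 2
        = 240 * log γ / γ + (H + a * lam1 * c) * (γ ^ 2 * exp (-(γ / 4))) := by
      field_simp
    unfold expansionError
    linarith
  have h0 : 0 ≤ e * (-log ρ) + b := add_nonneg (mul_nonneg he0 hlog0) hb0
  have h1 : exp (lam1 * (r - ρ)) ≤ exp lam1 := by
    apply exp_le_exp.2
    have : r - ρ ≤ 1 := by linarith [hr.2]
    nlinarith
  exact mul_le_mul hE h1 (exp_pos _).le (h0.trans hE)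

end NearEigen

/-- The squared norm defect of the expansion. -/
def normError (lam1 c κ m γ : ℝ) : ℝ :=
  (expansionError lam1 c κ m γ * exp lam1 + 2 / γ)
      * (1 + 4 * slopeBound lam1 c κ m + (heightBound lam1 c κ m + 1) / m * c)
    + (2 + 8 * slopeBound lam1 c κ m ^ 2 + ((heightBound lam1 c κ m + 1) / m * c) ^ 2)
      * exp (-(γ / 4))

/-- The uniform error of the expansion with the coefficient given by the `L²` norm. -/
def profileError (lam1 c κ m γ : ℝ) : ℝ :=
  expansionError lam1 c κ m γ * exp lam1
    + (2 * π * normError lam1 c κ m γ / (m / (κ * c)) + 480 / (γ * m)) * c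

namespace NearEigen

variable {lam β γ μ lam1 c κ ρ₂ r' : ℝ} {u v : ℝ → ℝ}

theorem abs_integral_sq_sub_le (D : NearEigen lam β γ μ lam1 c κ u v) {ρ A a τ : ℝ}
    (hρ0 : 0 < ρ) (hρ1 : ρ ≤ 1) (hA : |A| ≤ a) (hτ : 0 ≤ τ)
    (h : ∀ r ∈ Icc ρ 1, |u r + 2 / γ * log r - A * v r| ≤ τ) :
    |(∫ s in (0:ℝ)..1, s * u s ^ 2) - A ^ 2 * ∫ s in (0:ℝ)..1, s * v s ^ 2|
      ≤ (τ + 2 / γ) * (1 + 4 * slopeBound lam1 c κ (v (1 / 2)) + a * c)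
        + (2 + 8 * slopeBound lam1 c κ (v (1 / 2)) ^ 2 + (a * c) ^ 2) * ρ := by
  have hγ := D.center_pos
  have hc := D.eigen.center_pos
  set K := slopeBound lam1 c κ (v (1 / 2)) with hKdef
  have hK : 1 ≤ K := D.one_le_slopeBound
  have ha0 : 0 ≤ a := (abs_nonneg A).trans hA
  have hu := D.cont
  have hv := D.eigen.cont
  have hf : Continuous (fun s => s * u s ^ 2 - A ^ 2 * (s * v s ^ 2)) := by fun_prop
  have hbd : ∀ s ∈ Ioc (0:ℝ) 1, u s ≤ 1 + K * (-log s) ∧ 0 ≤ u s ∧ |A * v s| ≤ a * c := by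
    intro s hs
    have hs' := Ioc_subset_Icc_self hs
    refine ⟨D.le_one_add_slopeBound_mul hs, D.nonneg hs', ?_⟩
    rw [abs_mul, abs_of_nonneg (D.eigen.nonneg hs')]
    have := D.eigen.nonneg hs'
    have := D.eigen.le_center hs'
    gcongr
  have h1 : |∫ s in (0:ℝ)..ρ, (s * u s ^ 2 - A ^ 2 * (s * v s ^ 2))|
      ≤ (2 + 8 * K ^ 2 + (a * c) ^ 2) * ρ := by
    have := intervalIntegral.norm_integral_le_of_norm_le_const (a := 0) (b := ρ)
      (f := fun s => s * u s ^ 2 - A ^ 2 * (s * v s ^ 2)) (C := 2 + 8 * K ^ 2 + (a * c) ^ 2) (by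
        intro s hs
        rw [uIoc_of_le hρ0.le] at hs
        have hs1 : s ∈ Ioc (0:ℝ) 1 := ⟨hs.1, hs.2.trans hρ1⟩
        obtain ⟨h2, h3, h4⟩ := hbd s hs1
        have h5 := mul_log_sq_le_four hs.1 hs1.2
        have h6 : s * u s ^ 2 ≤ 2 + 8 * K ^ 2 := by
          calc s * u s ^ 2 ≤ s * (1 + K * (-log s)) ^ 2 := by
                have := hs.1
                gcongr
            _ = 2 * s + 2 * K ^ 2 * (s * log s ^ 2) - s * (1 + K * log s) ^ 2 := by ring
            _ ≤ 2 * 1 + 2 * K ^ 2 * 4 - 0 := by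
                have := hs.1
                gcongr
                · exact hs1.2
                · positivity
            _ = _ := by ring
        have h7 : A ^ 2 * (s * v s ^ 2) ≤ (a * c) ^ 2 := by
          calc A ^ 2 * (s * v s ^ 2) = s * |A * v s| ^ 2 := by
                rw [sq_abs]
                ring
            _ ≤ 1 * (a * c) ^ 2 := by
                gcongr
                exact hs1.2
            _ = _ := one_mul _
        have h8 : 0 ≤ s * u s ^ 2 := mul_nonneg hs.1.le (sq_nonneg _)
        have h9 : 0 ≤ A ^ 2 * (s * v s ^ 2) :=
          mul_nonneg (sq_nonneg _) (mul_nonneg hs.1.le (sq_nonneg _))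
        have h10 := sq_nonneg (a * c)
        have h11 : 0 ≤ 2 + 8 * K ^ 2 := by positivity
        rw [norm_eq_abs, abs_le]
        constructor <;> linarith)
    rwa [norm_eq_abs, sub_zero, abs_of_pos hρ0] at this
  have h2 : |∫ s in ρ..1, (s * u s ^ 2 - A ^ 2 * (s * v s ^ 2))|
      ≤ (τ + 2 / γ) * (1 + 4 * K + a * c) := by
    have := intervalIntegral.norm_integral_le_of_norm_le_const (a := ρ) (b := 1)
      (f := fun s => s * u s ^ 2 - A ^ 2 * (s * v s ^ 2))
      (C := (τ + 2 / γ) * (1 + 4 * K + a * c)) (by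
        intro s hs
        rw [uIoc_of_le hρ1] at hs
        have hs0 : 0 < s := hρ0.trans hs.1
        have hs1 : s ∈ Ioc (0:ℝ) 1 := ⟨hs0, hs.2⟩
        obtain ⟨h2, h3, h4⟩ := hbd s hs1
        have hls : 0 ≤ -log s := by linarith [log_nonpos hs0.le hs.2]
        have h5 := mul_log_sq_le_four hs0 hs.2
        have h6 := neg_mul_log_le_one hs0
        have h7 := h s ⟨hs.1.le, hs.2⟩
        have h8 : |u s - A * v s| ≤ τ + 2 / γ * (-log s) := by
          have h9 : 0 ≤ 2 / γ * (-log s) := by positivity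
          have h10 := abs_le.1 h7
          rw [abs_le]
          constructor <;> linarith
        have h9 : |u s + A * v s| ≤ 1 + K * (-log s) + a * c := by
          refine (abs_add_le _ _).trans ?_
          rw [abs_of_nonneg h3]
          linarith
        have e : s * u s ^ 2 - A ^ 2 * (s * v s ^ 2)
            = s * ((u s - A * v s) * (u s + A * v s)) := by ring
        rw [norm_eq_abs, e, abs_mul, abs_mul, abs_of_pos hs0]
        have hac : 0 ≤ a * c := by positivity
        calc s * (|u s - A * v s| * |u s + A * v s|)
            ≤ s * ((τ + 2 / γ * (-log s)) * (1 + K * (-log s) + a * c)) := by gcongr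
          _ = τ * (s * (1 + a * c) + K * (s * (-log s)))
              + 2 / γ * (s * (-log s) * (1 + a * c) + K * (s * log s ^ 2)) := by ring
          _ ≤ τ * (1 * (1 + a * c) + K * 1) + 2 / γ * (1 * (1 + a * c) + K * 4) := by
              gcongr
              exact hs.2
          _ ≤ _ := by
              have := mul_nonneg hτ (by linarith : 0 ≤ 3 * K)
              linarith)
    rw [norm_eq_abs] at this
    refine this.trans (mul_le_of_le_one_right ?_ ?_)
    · positivity
    · rw [abs_of_nonneg] <;> linarith
  have e : (∫ s in (0:ℝ)..1, s * u s ^ 2) - A ^ 2 * ∫ s in (0:ℝ)..1, s * v s ^ 2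
      = (∫ s in (0:ℝ)..ρ, (s * u s ^ 2 - A ^ 2 * (s * v s ^ 2)))
        + ∫ s in ρ..1, (s * u s ^ 2 - A ^ 2 * (s * v s ^ 2)) := by
    rw [intervalIntegral.integral_add_adjacent_intervals (hf.intervalIntegrable _ _)
      (hf.intervalIntegrable _ _), intervalIntegral.integral_sub,
      intervalIntegral.integral_const_mul]
    all_goals exact Continuous.intervalIntegrable (by fun_prop) _ _
  rw [e]
  refine (abs_add_le _ _).trans ?_
  linarith

theorem le_sqrt_integral_sq (D : NearEigen lam β γ μ lam1 c κ u v) :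
    v (1 / 2) / (κ * c) ≤ √(2 * π * ∫ s in (0:ℝ)..1, s * u s ^ 2) := by
  apply le_sqrt_of_sq_le
  have h := D.le_integral_sq
  have h1 := pi_gt_three
  have h2 := sq_nonneg (v (1 / 2) / (κ * c))
  nlinarith

theorem abs_sub_sqrt_mul_le (D : NearEigen lam β γ μ lam1 c κ u v)
    (C : CutRadii β γ μ u ρ₂ r') (hbig : 4 * (heightBound lam1 c κ (v (1 / 2)) + 3) ^ 2 < γ)
    (hnorm : 2 * π * (∫ s in (0:ℝ)..1, s * v s ^ 2) = 1) {r : ℝ} (hr : r ∈ Icc (min ρ₂ r') 1) :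
    |u r - (log (1 / r ^ 2) / γ + √(2 * π * ∫ s in (0:ℝ)..1, s * u s ^ 2) * v r)|
      ≤ profileError lam1 c κ (v (1 / 2)) γ := by
  have hγ := D.center_pos
  have hm := D.half_pos
  have hκ := D.gap_pos
  have hc := D.eigen.center_pos
  have hle := D.le_cut C
  have hcut := D.cut_le C hbig
  have hρ0 : 0 < min ρ₂ r' := (mul_pos D.scale_pos hγ).trans_le hle
  have hρh : min ρ₂ r' ≤ 1 / 2 := by
    refine hcut.trans (D.exp_neg_div_four_le.trans ?_)
    rw [inv_le_comm₀ (by positivity) (by norm_num)]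
    nlinarith [D.large]
  have hexp := fun {x : ℝ} (hx : x ∈ Icc (min ρ₂ r') 1) =>
    D.abs_sub_matchCoeff_mul_le hle hcut (D.half_le_cut C hbig) (D.exp_cut_le C hbig) hx
  have hA := D.abs_matchCoeff_le hle hρh
  have hA' := D.le_matchCoeff hle hρh
  set ρ := min ρ₂ r' with hρ
  set A := matchCoeff γ u v ρ with hAdef
  set τ := expansionError lam1 c κ (v (1 / 2)) γ * exp lam1 with hτdef
  set n := √(2 * π * ∫ s in (0:ℝ)..1, s * u s ^ 2) with hn
  have hτ : 0 ≤ τ := (abs_nonneg _).trans (hexp hr)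
  have hI := D.abs_integral_sq_sub_le hρ0 (by linarith) hA hτ (fun x hx => hexp hx)
  have hc0 : 0 < v (1 / 2) / (κ * c) := by positivity
  have hn0 : v (1 / 2) / (κ * c) ≤ n := D.le_sqrt_integral_sq
  have hI0 : 0 ≤ ∫ s in (0:ℝ)..1, s * u s ^ 2 :=
    intervalIntegral.integral_nonneg zero_le_one fun s hs => mul_nonneg hs.1 (sq_nonneg _)
  have hnsq : n ^ 2 = 2 * π * ∫ s in (0:ℝ)..1, s * u s ^ 2 := sq_sqrt (by positivity)
  have hN : |n ^ 2 - A ^ 2| ≤ 2 * π * normError lam1 c κ (v (1 / 2)) γ := by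
    have e : n ^ 2 - A ^ 2 = 2 * π * ((∫ s in (0:ℝ)..1, s * u s ^ 2)
        - A ^ 2 * ∫ s in (0:ℝ)..1, s * v s ^ 2) := by
      rw [hnsq, mul_sub]
      linear_combination A ^ 2 * hnorm
    rw [e, abs_mul, abs_of_pos (by positivity : 0 < 2 * π)]
    gcongr
    refine hI.trans ?_
    unfold normError
    have := D.one_le_slopeBound
    gcongr
  have h1 : |n - abs A| ≤ 2 * π * normError lam1 c κ (v (1 / 2)) γ / (v (1 / 2) / (κ * c)) := by
    rw [le_div_iff₀ hc0]
    refine le_trans ?_ hN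
    have e : n ^ 2 - A ^ 2 = (n - |A|) * (n + |A|) := by
      rw [← sq_abs A]
      ring
    have h3 := abs_nonneg A
    rw [e, abs_mul, abs_of_nonneg (by linarith : 0 ≤ n + |A|)]
    gcongr
    linarith
  have h2 : |abs A - A| ≤ 480 / (γ * v (1 / 2)) := by
    have h3 : 0 ≤ 240 / (γ * v (1 / 2)) := by positivity
    have e : 480 / (γ * v (1 / 2)) = 2 * (240 / (γ * v (1 / 2))) := by ring
    rw [e]
    rcases abs_cases A with ⟨h4, h5⟩ | ⟨h4, h5⟩
    · rw [h4, sub_self, abs_zero]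
      linarith
    · rw [h4, abs_le]
      constructor <;> linarith
  have h3 : |n - A| ≤ 2 * π * normError lam1 c κ (v (1 / 2)) γ / (v (1 / 2) / (κ * c))
      + 480 / (γ * v (1 / 2)) :=
    (abs_sub_le n (abs A) A).trans (add_le_add h1 h2)
  have hr0 : 0 < r := hρ0.trans_le hr.1
  have hrI : r ∈ Icc (0:ℝ) 1 := ⟨hr0.le, hr.2⟩
  have e : u r - (log (1 / r ^ 2) / γ + n * v r)
      = (u r + 2 / γ * log r - A * v r) - (n - A) * v r := by
    rw [one_div, log_inv, log_pow]
    push_cast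
    ring
  rw [e]
  refine (abs_sub _ _).trans (add_le_add (hexp hr) ?_)
  rw [abs_mul, abs_of_nonneg (D.eigen.nonneg hrI)]
  exact mul_le_mul h3 (D.eigen.le_center hrI) (D.eigen.nonneg hrI) ((abs_nonneg _).trans h3)

end NearEigen

theorem l2norm_eq_sqrt (u : ℝ → ℝ) :
    l2norm u = √(2 * π * ∫ s in (0:ℝ)..1, s * clampExt u s ^ 2) := by
  unfold l2norm
  congr 1
  rw [intervalIntegral.integral_of_le zero_le_one, integral_Ioc_eq_integral_Ioo,
    ← integral_const_mul]
  refine setIntegral_congr_fun measurableSet_Ioo fun s hs => ?_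
  simp only [clampExt_eq u (Ioo_subset_Icc_self hs)]
  ring

theorem tendsto_expansionError (lam1 c κ m : ℝ) :
    Tendsto (expansionError lam1 c κ m) atTop (𝓝 0) := by
  have h1 : Tendsto (fun x : ℝ => log x / x) atTop (𝓝 0) :=
    isLittleO_log_id_atTop.tendsto_div_nhds_zero
  have h2 : Tendsto (fun x : ℝ => x ^ 2 * exp (-(x / 4))) atTop (𝓝 0) := by
    have h := ((tendsto_pow_mul_exp_neg_atTop_nhds_zero 2).comp
      (tendsto_id.atTop_div_const (by norm_num : (0:ℝ) < 4))).const_mul 16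
    rw [mul_zero] at h
    refine h.congr fun x => ?_
    simp only [Function.comp, id]
    ring
  have h3 : Tendsto (fun x : ℝ => x⁻¹) atTop (𝓝 0) := tendsto_inv_atTop_zero
  have h := ((h1.const_mul 240).add (h2.const_mul (heightBound lam1 c κ m
    + (heightBound lam1 c κ m + 1) / m * lam1 * c))).add ((h3.const_mul (lam1 * 2)).add
    ((((h3.pow 2).add (h3.const_mul (exp 4 * κ))).add (h3.const_mul κ)).mul_const
      (1 + slopeBound lam1 c κ m)))
  simp only [mul_zero, add_zero, zero_mul, ne_eq, OfNat.ofNat_ne_zero, not_false_eq_true,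
    zero_pow] at h
  refine h.congr fun x => ?_
  unfold expansionError
  rw [inv_pow]
  ring

theorem tendsto_exp_neg_div_four : Tendsto (fun x : ℝ => exp (-(x / 4))) atTop (𝓝 0) :=
  tendsto_exp_neg_atTop_nhds_zero.comp (tendsto_id.atTop_div_const (by norm_num : (0:ℝ) < 4))

theorem tendsto_profileError (lam1 c κ m : ℝ) :
    Tendsto (profileError lam1 c κ m) atTop (𝓝 0) := by
  have h1 := tendsto_expansionError lam1 c κ m
  have h2 := tendsto_exp_neg_div_four
  have h3 : Tendsto (fun x : ℝ => x⁻¹) atTop (𝓝 0) := tendsto_inv_atTop_zero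
  have hN : Tendsto (normError lam1 c κ m) atTop (𝓝 0) := by
    have h := (((h1.mul_const (exp lam1)).add (h3.const_mul 2)).mul_const
      (1 + 4 * slopeBound lam1 c κ m + (heightBound lam1 c κ m + 1) / m * c)).add
      (h2.const_mul (2 + 8 * slopeBound lam1 c κ m ^ 2
        + ((heightBound lam1 c κ m + 1) / m * c) ^ 2))
    simp only [mul_zero, add_zero, zero_mul] at h
    exact h
  have h := (h1.mul_const (exp lam1)).add
    ((((hN.const_mul (2 * π)).div_const (m / (κ * c))).add (h3.const_mul (480 / m))).mul_const c)
  simp only [mul_zero, add_zero, zero_mul, zero_div] at h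
  refine h.congr fun x => ?_
  unfold profileError
  ring

theorem EigenCtx.isRadSol {lam1 : ℝ} {v1 : ℝ → ℝ} (hE : EigenCtx lam1 v1) :
    IsRadSol lam1 0 (v1 0) v1 := by
  obtain ⟨_, hs, hode, hpos, h1, _⟩ := hE
  exact ⟨hs, fun r hr => by rw [hode r hr]; ring, hpos, h1, rfl⟩

theorem EigenCtx.two_pi_mul_integral {lam1 : ℝ} {v1 : ℝ → ℝ} (hE : EigenCtx lam1 v1) :
    2 * π * (∫ s in (0:ℝ)..1, s * clampExt v1 s ^ 2) = 1 := by
  have h := l2norm_eq_sqrt v1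
  rw [l2norm, hE.2.2.2.2.2, sqrt_one] at h
  have h1 := h.symm
  rwa [sqrt_eq_one] at h1

theorem eventually_mul_log_le (C : ℝ) : ∀ᶠ γ : ℝ in atTop, C * log γ ≤ γ := by
  have h1 : Tendsto (fun x : ℝ => log x / x) atTop (𝓝 0) :=
    isLittleO_log_id_atTop.tendsto_div_nhds_zero
  have h2 := h1.const_mul C
  rw [mul_zero] at h2
  filter_upwards [h2.eventually_le_const one_pos, eventually_gt_atTop 0] with γ h h0
  rwa [← mul_div_assoc, div_le_one h0] at h

theorem eventually_exp_neg_le {κ : ℝ} (hκ : 0 < κ) :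
    ∀ᶠ γ : ℝ in atTop, exp (-γ) ≤ κ / γ / 2 := by
  have h := tendsto_pow_mul_exp_neg_atTop_nhds_zero 1
  filter_upwards [h.eventually_le_const (half_pos hκ), eventually_gt_atTop 0] with γ h h0
  rw [pow_one] at h
  rw [div_right_comm, le_div_iff₀ h0]
  linarith

theorem lamBar_eq (lam1 v10 l γ : ℝ) :
    lamBar lam1 v10 l γ = lam1 - 4 * π * v10 * √(lam1 / l) / γ := by
  unfold lamBar
  ring

theorem CutRadii.of_clampExt {β γ μ ρ₂ r' : ℝ} {u : ℝ → ℝ}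
    (h2 : 0 < ρ₂) (h2' : tG μ ρ₂ = γ ^ 2 - γ)
    (h : (β < (γ ^ 2)⁻¹ ∧ (γ ^ 2)⁻¹ < β * exp (γ ^ 2)) →
      r' ∈ Ioo (0:ℝ) 1 ∧ β * exp ((u r') ^ 2) = (γ ^ 2)⁻¹)
    (hne : ¬(β < (γ ^ 2)⁻¹ ∧ (γ ^ 2)⁻¹ < β * exp (γ ^ 2)) → r' = 1) :
    CutRadii β γ μ (clampExt u) ρ₂ r' where
  pos := h2
  eq := by
    rw [← h2', tG, exp_log (by positivity)]
  of_mem hb := by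
    obtain ⟨h3, h4⟩ := h hb
    refine ⟨h3, ?_⟩
    rwa [clampExt_eq u (Ioo_subset_Icc_self h3)]
  of_not_mem := hne

/-- As γ → +∞: (i) liminf ‖u_γ‖_{L²(Ω)} > 0; (ii) ρ_γ → 0, where
ρ_γ = min(ρ_{2,γ}, r'_γ); (iii) u_γ(r) = γ⁻¹ log(1/r²) + ‖u_γ‖₂ v₁(r) + o(‖u_γ‖₂)
uniformly for r ∈ [ρ_γ, 1]. -/
theorem statement10 (lam1 : ℝ) (v1 : ℝ → ℝ) (hE : EigenCtx lam1 v1) (l : ℝ) (hl : 0 < l)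
    (β : ℝ → ℝ) (u : ℝ → ℝ → ℝ) (hF : GoodFamily lam1 v1 l β u)
    (μ : ℝ → ℝ)
    (hμ : ∀ γ : ℝ, 0 < γ → 0 < lamBar lam1 (v1 0) l γ →
      0 < μ γ ∧ β γ * γ ^ 2 * Real.exp (γ ^ 2) * (μ γ) ^ 2 = 4)
    (ρ2 r' : ℝ → ℝ)
    (hρ2 : ∀ γ : ℝ, 0 < γ → 0 < lamBar lam1 (v1 0) l γ →
      0 < ρ2 γ ∧ tG (μ γ) (ρ2 γ) = γ ^ 2 - γ)
    (hr' : ∀ γ : ℝ, 0 < γ → 0 < lamBar lam1 (v1 0) l γ →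
      ((β γ < (γ ^ 2)⁻¹ ∧ (γ ^ 2)⁻¹ < β γ * Real.exp (γ ^ 2)) →
        r' γ ∈ Set.Ioo (0:ℝ) 1 ∧ β γ * Real.exp ((u γ (r' γ)) ^ 2) = (γ ^ 2)⁻¹) ∧
      (¬(β γ < (γ ^ 2)⁻¹ ∧ (γ ^ 2)⁻¹ < β γ * Real.exp (γ ^ 2)) → r' γ = 1)) :
    (∃ c : ℝ, 0 < c ∧ ∀ᶠ γ in atTop, c ≤ l2norm (u γ)) ∧
    Tendsto (fun γ : ℝ => min (ρ2 γ) (r' γ)) atTop (𝓝 0) ∧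
    (∀ ε : ℝ, 0 < ε → ∀ᶠ γ in atTop,
      ∀ r ∈ Set.Icc (min (ρ2 γ) (r' γ)) 1,
        |u γ r - (Real.log (1 / r ^ 2) / γ + l2norm (u γ) * v1 r)|
          ≤ ε * l2norm (u γ)) := by
  have hlam1 : 0 < lam1 := hE.1
  have Q := hE.isRadSol.radialProfile hlam1.le le_rfl
  have hnorm := hE.two_pi_mul_integral
  set v := clampExt v1 with hv
  set c := v1 0 with hc
  set κ := 4 * π * c * √(lam1 / l) with hκdef
  have hc0 : 0 < c := Q.center_pos
  have hκ : 0 < κ := by positivity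
  have hm : 0 < v (1 / 2) := Q.pos _ (by norm_num)
  set H := heightBound lam1 c κ (v (1 / 2)) with hH
  have key : ∀ᶠ γ : ℝ in atTop, 4 * (H + 3) ^ 2 < γ ∧
      NearEigen (lamBar lam1 c l γ) (β γ) γ (μ γ) lam1 c κ (clampExt (u γ)) v ∧
      CutRadii (β γ) γ (μ γ) (clampExt (u γ)) (ρ2 γ) (r' γ) := by
    have hκγ : Tendsto (fun γ : ℝ => κ / γ) atTop (𝓝 0) := tendsto_const_nhds.div_atTop tendsto_id
    filter_upwards [eventually_ge_atTop (10 ^ 6), eventually_mul_log_le (10 ^ 6),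
      eventually_mul_log_le (250 * (1 + lam1 * (80 * c / (κ * v (1 / 2))))),
      eventually_ge_atTop lam1, hκγ.eventually_lt_const hlam1, eventually_exp_neg_le hκ,
      eventually_gt_atTop (4 * (H + 3) ^ 2)] with γ hγ hlog hlog' hlamγ hκlt hexp hbig
    have hγ0 : 0 < γ := by linarith
    have hgap : lam1 - lamBar lam1 c l γ = κ / γ := by
      rw [lamBar_eq]
      ring
    have hbar : 0 < lamBar lam1 c l γ := by linarith
    have hle : lamBar lam1 c l γ ≤ γ := by linarith [div_pos hκ hγ0]
    obtain ⟨hβ, hu⟩ := hF γ hγ0 hbar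
    obtain ⟨hμ0, hs⟩ := hμ γ hγ0 hbar
    obtain ⟨hρ, hρ'⟩ := hρ2 γ hγ0 hbar
    obtain ⟨hr1, hr2⟩ := hr' γ hγ0 hbar
    have P := hu.radialProfile hbar.le hβ.le
    refine ⟨hbig, ?_, CutRadii.of_clampExt hρ hρ' hr1 hr2⟩
    exact
      { toRadialProfile := P
        beta_pos := hβ
        scale_pos := hμ0
        scale_eq := hs
        lam_le := hle
        scale_le := P.scale_mul_pow_le_one Q hκ hgap hμ0 hγ hlog hs hle hexp hlog'
        large := hγ
        log_le := hlog
        eigen := Q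
        gap_pos := hκ
        gap_eq := hgap }
  have hlow : ∀ᶠ γ : ℝ in atTop, v (1 / 2) / (κ * c) ≤ l2norm (u γ) := by
    filter_upwards [key] with γ ⟨_, D, _⟩
    rw [l2norm_eq_sqrt]
    exact D.le_sqrt_integral_sq
  have hlow0 : 0 < v (1 / 2) / (κ * c) := by positivity
  refine ⟨⟨_, hlow0, hlow⟩, ?_, fun ε hε => ?_⟩
  · refine tendsto_of_tendsto_of_tendsto_of_le_of_le' tendsto_const_nhds
      tendsto_exp_neg_div_four ?_ ?_
    · filter_upwards [key] with γ ⟨_, D, C⟩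
      exact (mul_pos D.scale_pos D.center_pos).le.trans (D.le_cut C)
    · filter_upwards [key] with γ ⟨hbig, D, C⟩
      exact D.cut_le C hbig
  · filter_upwards [key, hlow, (tendsto_profileError lam1 c κ (v (1 / 2))).eventually_le_const
      (mul_pos hε hlow0)] with γ ⟨hbig, D, C⟩ hγ herr r hr
    have hr0 : 0 < r := ((mul_pos D.scale_pos D.center_pos).trans_le (D.le_cut C)).trans_le hr.1
    have h := D.abs_sub_sqrt_mul_le C hbig hnorm hr
    rw [← l2norm_eq_sqrt, hv, clampExt_eq _ ⟨hr0.le, hr.2⟩, clampExt_eq _ ⟨hr0.le, hr.2⟩] at h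
    refine h.trans (herr.trans ?_)
    gcongr

end
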